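/- arXiv:2212.09378 — 6 statements merged into one kernel-verified Lean document; each statement's English description precedes it below -/
import Mathlib

section
/- Let F = {f_1, …, f_m} be a CPLIFS with attractor Λ and natural projection Π. Suppose that every breaking point of F that lies in Λ has only finitely many codings, and every such coding is periodic. Then Λ is the attractor of a self-similar graph-directed iterated function system: there exist q ≥ 1, nonempty compact sets Λ_1, …, Λ_q with Λ = Λ_1 ∪ … ∪ Λ_q, a finite set E of edges, each edge e carrying a source s(e) ∈ {1,…,q}, a target t(e) ∈ {1,…,q} and a contracting affine map g_e : ℝ → ℝ with nonzero slope, such that Λ_i = ⋃_{e : s(e)=i} g_e(Λ_{t(e)}) for every i ∈ {1,…,q}; moreover there exists P ≥ 1 such that every g_e agrees on Λ_{t(e)} with f_w for some word w ∈ {1,…,m}^P. -/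
open Set Filter MeasureTheory Topology

noncomputable section

/-- For a word `w = [i₁, …, iₙ]`, `fw f w = f i₁ ∘ ⋯ ∘ f iₙ`. -/
def fw {m : ℕ} (f : Fin m → ℝ → ℝ) : List (Fin m) → ℝ → ℝ :=
  fun w => w.foldr (fun k g => f k ∘ g) id

/-- `InPiece bk i x` means that `x` belongs to the (closure of the) `i`-th interval of
linearity determined by the strictly increasing breaking points `bk`. -/
def InPiece {L : ℕ} (bk : Fin L → ℝ) (i : Fin (L + 1)) (x : ℝ) : Prop :=
  (∀ j : Fin L, (j : ℕ) < (i : ℕ) → bk j ≤ x) ∧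
  (∀ j : Fin L, (i : ℕ) ≤ (j : ℕ) → x ≤ bk j)

/-- A continuous piecewise linear iterated function system on `ℝ` with `m` maps:
each `f k` has `l k` breaking points `b k 0 < ⋯ < b k (l k - 1)`, is affine with slope
`ρ k i ∈ (-1,1) \ {0}` on the `i`-th interval of linearity, and has distinct slopes on
consecutive intervals. -/
structure CPLIFS (m : ℕ) where
  f : Fin m → ℝ → ℝ
  l : Fin m → ℕ
  b : (k : Fin m) → Fin (l k) → ℝ
  ρ : (k : Fin m) → Fin (l k + 1) → ℝ
  hm : 2 ≤ m
  hb : ∀ k, StrictMono (b k)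
  hρ0 : ∀ k i, ρ k i ≠ 0
  hρ1 : ∀ k i, |ρ k i| < 1
  hρne : ∀ k (i : Fin (l k)), ρ k i.castSucc ≠ ρ k i.succ
  hpiece : ∀ k (i : Fin (l k + 1)) (x y : ℝ),
    InPiece (b k) i x → InPiece (b k) i y → f k x - f k y = ρ k i * (x - y)

/-- `Λ` is the attractor of `F`: the (unique) nonempty compact set with `Λ = ⋃ₖ f k (Λ)`. -/
def IsAttractor {m : ℕ} (F : CPLIFS m) (Λ : Set ℝ) : Prop :=
  Λ.Nonempty ∧ IsCompact Λ ∧ Λ = ⋃ k, F.f k '' Λ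

/-- `c ∈ {1,…,m}^ℕ` is a coding of `x`: the natural projection sends `c` to `x`. -/
def IsCoding {m : ℕ} (F : CPLIFS m) (c : ℕ → Fin m) (x : ℝ) : Prop :=
  ∀ x₀ : ℝ, Tendsto (fun n => fw F.f (List.ofFn fun j : Fin n => c j) x₀) atTop (nhds x)

/-- `x` is a breaking point of (one of the maps of) `F`. -/
def IsBreakPoint {m : ℕ} (F : CPLIFS m) (x : ℝ) : Prop := ∃ k j, F.b k j = x

lemma fw_cons {m : ℕ} (f : Fin m → ℝ → ℝ) (k : Fin m) (w : List (Fin m)) (x : ℝ) :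
    fw f (k :: w) x = f k (fw f w x) := rfl

lemma fw_append_singleton {m : ℕ} (f : Fin m → ℝ → ℝ) (w : List (Fin m)) (k : Fin m) (x : ℝ) :
    fw f (w ++ [k]) x = fw f w (f k x) := by
  induction w with
  | nil => rfl
  | cons j w ih => rw [List.cons_append, fw_cons, fw_cons, ih]

/-- `K` does not have points on both sides of `x`. -/
def OneSided (K : Set ℝ) (x : ℝ) : Prop := (∀ y ∈ K, y ≤ x) ∨ (∀ y ∈ K, x ≤ y)

lemma exists_inPiece_of_oneSided {L : ℕ} {bk : Fin L → ℝ} (hb : StrictMono bk) {K : Set ℝ}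
    (hK : ∀ j, OneSided K (bk j)) : ∃ i, ∀ x ∈ K, InPiece bk i x := by
  classical
  have hex : ∃ n, n = L ∨ ∃ h : n < L, ∀ x ∈ K, x ≤ bk ⟨n, h⟩ := ⟨L, Or.inl rfl⟩
  have hle : Nat.find hex ≤ L := Nat.find_min' hex (Or.inl rfl)
  refine ⟨⟨Nat.find hex, Nat.lt_succ_of_le hle⟩, fun x hx => ⟨fun j hj => ?_, fun j hj => ?_⟩⟩
  · have hmin := Nat.find_min hex hj
    rcases hK j with h | h
    · exact absurd (Or.inr ⟨j.2, h⟩) hmin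
    · exact h x hx
  · rcases Nat.find_spec hex with h | ⟨h, h'⟩
    · have := j.2
      simp only at hj
      omega
    · exact (h' x hx).trans (hb.monotone hj)

/-- A map that is Lipschitz between consecutive points of a finite set is Lipschitz. -/
lemma abs_sub_le_of_locally {h : ℝ → ℝ} {c : ℝ} (D : Finset ℝ)
    (hD : ∀ x y, x ≤ y → (∀ d ∈ D, d ≤ x ∨ y ≤ d) → |h x - h y| ≤ c * (y - x)) :
    ∀ x y, x ≤ y → |h x - h y| ≤ c * (y - x) := by
  classical
  suffices H : ∀ n x y, (D.filter fun d => x < d ∧ d < y).card = n → x ≤ y →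
      |h x - h y| ≤ c * (y - x) from fun x y hxy => H _ x y rfl hxy
  intro n
  induction n using Nat.strong_induction_on with
  | _ n ih =>
    intro x y hn hxy
    by_cases hempty : ∀ d ∈ D, d ≤ x ∨ y ≤ d
    · exact hD x y hxy hempty
    · push Not at hempty
      obtain ⟨d, hdD, hxd, hdy⟩ := hempty
      have h1 : (D.filter fun e => x < e ∧ e < d).card < n := by
        rw [← hn]
        refine Finset.card_lt_card (Finset.ssubset_iff_of_subset ?_ |>.2 ⟨d, ?_, ?_⟩)
        · intro e he
          simp only [Finset.mem_filter] at he ⊢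
          exact ⟨he.1, he.2.1, he.2.2.trans hdy⟩
        · simp [hdD, hxd, hdy]
        · simp
      have h2 : (D.filter fun e => d < e ∧ e < y).card < n := by
        rw [← hn]
        refine Finset.card_lt_card (Finset.ssubset_iff_of_subset ?_ |>.2 ⟨d, ?_, ?_⟩)
        · intro e he
          simp only [Finset.mem_filter] at he ⊢
          exact ⟨he.1, hxd.trans he.2.1, he.2.2⟩
        · simp [hdD, hxd, hdy]
        · simp
      have e1 := ih _ h1 x d rfl hxd.le
      have e2 := ih _ h2 d y rfl hdy.le
      have e3 := abs_sub_le (h x) (h d) (h y)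
      linarith

namespace CPLIFS

variable {m : ℕ} (F : CPLIFS m)

/-- The set of all breaking points. -/
def breakPoints : Set ℝ := {x | IsBreakPoint F x}

lemma finite_breakPoints : F.breakPoints.Finite := by
  have : F.breakPoints = Set.range fun p : (Σ k, Fin (F.l k)) => F.b p.1 p.2 := by
    ext x
    simp [breakPoints, IsBreakPoint]
  rw [this]
  exact Set.finite_range _

lemma nonempty_index {m : ℕ} (F : CPLIFS m) : Nonempty (Fin m) :=
  Fin.pos_iff_nonempty.1 (two_pos.trans_le F.hm)

lemma exists_contraction_ratio : ∃ c : ℝ, 0 ≤ c ∧ c < 1 ∧ ∀ k i, |F.ρ k i| ≤ c := by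
  obtain ⟨k₀⟩ := F.nonempty_index
  have : Nonempty (Σ k, Fin (F.l k + 1)) := ⟨⟨k₀, 0⟩⟩
  obtain ⟨p, hp⟩ := Finite.exists_max fun p : (Σ k, Fin (F.l k + 1)) => |F.ρ p.1 p.2|
  exact ⟨_, abs_nonneg _, F.hρ1 p.1 p.2, fun k i => hp ⟨k, i⟩⟩

lemma abs_sub_le {c : ℝ} (hc : ∀ k i, |F.ρ k i| ≤ c) (k : Fin m) (x y : ℝ) :
    |F.f k x - F.f k y| ≤ c * |x - y| := by
  have key : ∀ x y, x ≤ y → |F.f k x - F.f k y| ≤ c * (y - x) := by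
    refine abs_sub_le_of_locally (Finset.univ.image (F.b k)) fun x y hxy hD => ?_
    obtain ⟨i, hi⟩ := exists_inPiece_of_oneSided (F.hb k) (K := {x, y}) fun j => by
      rcases hD (F.b k j) (by simp) with h | h
      · exact Or.inr (by rintro z (rfl | rfl) <;> linarith)
      · exact Or.inl (by rintro z (rfl | rfl) <;> linarith)
    rw [F.hpiece k i x y (hi x (by simp)) (hi y (by simp)), abs_mul, abs_sub_comm x y,
      abs_of_nonneg (sub_nonneg.2 hxy)]
    exact mul_le_mul_of_nonneg_right (hc k i) (sub_nonneg.2 hxy)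
  rcases le_total x y with h | h
  · rw [abs_sub_comm x y, abs_of_nonneg (sub_nonneg.2 h)]
    exact key x y h
  · rw [abs_sub_comm (F.f k x), abs_of_nonneg (sub_nonneg.2 h)]
    exact key y x h

lemma continuous_f (k : Fin m) : Continuous (F.f k) := by
  obtain ⟨c, hc0, -, hc⟩ := F.exists_contraction_ratio
  exact (LipschitzWith.of_dist_le_mul (K := ⟨c, hc0⟩) fun x y => F.abs_sub_le hc k x y).continuous

lemma abs_fw_sub_le {c : ℝ} (hc0 : 0 ≤ c) (hc : ∀ k i, |F.ρ k i| ≤ c) (w : List (Fin m))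
    (x y : ℝ) : |fw F.f w x - fw F.f w y| ≤ c ^ w.length * |x - y| := by
  induction w with
  | nil => simp [fw]
  | cons k w ih =>
    rw [fw_cons, fw_cons, List.length_cons, pow_succ', mul_assoc]
    exact (F.abs_sub_le hc k _ _).trans (mul_le_mul_of_nonneg_left ih hc0)

lemma finite_fiber (k : Fin m) (y : ℝ) : {x | F.f k x = y}.Finite := by
  have hsub : {x | F.f k x = y} ⊆ ⋃ i, {x | InPiece (F.b k) i x ∧ F.f k x = y} := by
    intro x hx
    obtain ⟨i, hi⟩ := exists_inPiece_of_oneSided (F.hb k) (K := {x}) fun j => by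
      rcases le_total x (F.b k j) with h | h
      · exact Or.inl (by rintro z rfl; exact h)
      · exact Or.inr (by rintro z rfl; exact h)
    exact Set.mem_iUnion.2 ⟨i, hi x rfl, hx⟩
  refine (Set.finite_iUnion fun i => Set.Subsingleton.finite ?_).subset hsub
  rintro x ⟨hx, hxy⟩ z ⟨hz, hzy⟩
  have h := F.hpiece k i x z hx hz
  rw [hxy, hzy, sub_self, zero_eq_mul] at h
  exact sub_eq_zero.1 (h.resolve_left (F.hρ0 k i))

/-- On a set with no points on both sides of a breaking point, `f k` is affine. -/
lemma exists_affine (k : Fin m) {K : Set ℝ} (hK : ∀ x ∈ F.breakPoints, OneSided K x) :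
    ∃ r t : ℝ, (r ≠ 0 ∧ |r| < 1) ∧ ∀ x ∈ K, r * x + t = F.f k x := by
  obtain ⟨i, hi⟩ := exists_inPiece_of_oneSided (F.hb k) fun j => hK (F.b k j) ⟨k, j, rfl⟩
  rcases K.eq_empty_or_nonempty with rfl | ⟨x₀, hx₀⟩
  · exact ⟨F.ρ k i, 0, ⟨F.hρ0 k i, F.hρ1 k i⟩, by simp⟩
  · refine ⟨F.ρ k i, F.f k x₀ - F.ρ k i * x₀, ⟨F.hρ0 k i, F.hρ1 k i⟩, fun x hx => ?_⟩
    linarith [F.hpiece k i x x₀ (hi x hx) (hi x₀ hx₀)]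

end CPLIFS

section Coding

variable {m : ℕ} {F : CPLIFS m}

lemma IsCoding.cons {c : ℕ → Fin m} {y : ℝ} (hc : IsCoding F c y) (k : Fin m) :
    IsCoding F (fun n => Nat.casesOn n k c) (F.f k y) := by
  intro x₀
  rw [← tendsto_add_atTop_iff_nat 1]
  have h := ((F.continuous_f k).tendsto y).comp (hc x₀)
  refine h.congr fun n => ?_
  rw [List.ofFn_succ, fw_cons]
  rfl

lemma IsCoding.exists_append {c : ℕ → Fin m} {y : ℝ} (hc : IsCoding F c y) (w : List (Fin m)) :
    ∃ d, IsCoding F d (fw F.f w y) ∧ c = fun n => d (n + w.length) := by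
  induction w with
  | nil => exact ⟨c, hc, rfl⟩
  | cons k w ih =>
    obtain ⟨d, hd, hcd⟩ := ih
    exact ⟨_, hd.cons k, hcd⟩

lemma IsCoding.unique {c : ℕ → Fin m} {x y : ℝ} (hx : IsCoding F c x) (hy : IsCoding F c y) :
    x = y :=
  tendsto_nhds_unique (hx 0) (hy 0)

variable {Λ : Set ℝ}

lemma IsAttractor.map_mem (hΛ : IsAttractor F Λ) (k : Fin m) {x : ℝ} (hx : x ∈ Λ) :
    F.f k x ∈ Λ := by
  rw [hΛ.2.2]
  exact Set.mem_iUnion.2 ⟨k, x, hx, rfl⟩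

lemma IsAttractor.fw_mem (hΛ : IsAttractor F Λ) (w : List (Fin m)) {x : ℝ} (hx : x ∈ Λ) :
    fw F.f w x ∈ Λ := by
  induction w with
  | nil => exact hx
  | cons k w ih => exact hΛ.map_mem k ih

lemma IsAttractor.exists_preimage (hΛ : IsAttractor F Λ) {x : ℝ} (hx : x ∈ Λ) :
    ∃ k, ∃ y ∈ Λ, F.f k y = x := by
  rw [hΛ.2.2] at hx
  exact Set.mem_iUnion.1 hx

lemma IsAttractor.exists_coding (hΛ : IsAttractor F Λ) {y : ℝ} (hy : y ∈ Λ) :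
    ∃ c, IsCoding F c y := by
  have := F.nonempty_index
  choose! k g hg hfg using fun (x : ℝ) (hx : x ∈ Λ) => hΛ.exists_preimage hx
  have hmem : ∀ n, g^[n] y ∈ Λ := by
    intro n
    induction n with
    | zero => exact hy
    | succ n ih => rw [Function.iterate_succ_apply']; exact hg _ ih
  have hfw : ∀ n, ∀ x ∈ Λ, fw F.f (List.ofFn fun j : Fin n => k (g^[j] x)) (g^[n] x) = x := by
    intro n
    induction n with
    | zero => intro x _; rfl
    | succ n ih =>
      intro x hx
      rw [List.ofFn_succ, fw_cons]
      have := ih (g x) (hg x hx)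
      simp only [Fin.val_zero, Function.iterate_zero, id, Fin.val_succ, Function.iterate_succ,
        Function.comp]
      rw [this, hfg x hx]
  refine ⟨fun n => k (g^[n] y), fun x₀ => ?_⟩
  obtain ⟨c, hc0, hc1, hc⟩ := F.exists_contraction_ratio
  obtain ⟨R, hR⟩ := (Metric.isBounded_iff_subset_closedBall x₀).1 hΛ.2.1.isBounded
  have hlim : Tendsto (fun n => c ^ n * R) atTop (𝓝 0) := by
    simpa using (tendsto_pow_atTop_nhds_zero_of_lt_one hc0 hc1).mul_const R
  refine tendsto_iff_dist_tendsto_zero.2 (squeeze_zero (fun _ => dist_nonneg) (fun n => ?_) hlim)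
  have h := F.abs_fw_sub_le hc0 hc (List.ofFn fun j : Fin n => k (g^[j] y)) x₀ (g^[n] y)
  rw [hfw n y hy, List.length_ofFn] at h
  refine h.trans (mul_le_mul_of_nonneg_left ?_ (pow_nonneg hc0 n))
  have := hR (hmem n)
  rwa [Metric.mem_closedBall, dist_comm] at this

/-- The points of the attractor that some `f_w` maps to a breaking point. -/
def prebreakPoints (F : CPLIFS m) (Λ : Set ℝ) : Set ℝ :=
  {y ∈ Λ | ∃ w, fw F.f w y ∈ F.breakPoints}

lemma Function.Periodic.finite_shifts {α : Type*} {c : ℕ → α} {p : ℕ} (hp : 1 ≤ p)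
    (hc : Function.Periodic c p) : (Set.range fun j n => c (n + j)).Finite := by
  refine ((Set.finite_Iio p).image fun j n => c (n + j)).subset ?_
  rintro _ ⟨j, rfl⟩
  refine ⟨j % p, Nat.mod_lt _ hp, funext fun n => ?_⟩
  have := hc.nat_mul (j / p) (n + j % p)
  simp only at this ⊢
  rw [← this]
  congr 1
  have := Nat.div_add_mod j p
  simp only [Nat.cast_id]
  linarith [mul_comm p (j / p)]

lemma IsAttractor.finite_prebreakPoints (hΛ : IsAttractor F Λ)
    (hbrk : ∀ x ∈ Λ, IsBreakPoint F x →
      {c : ℕ → Fin m | IsCoding F c x}.Finite ∧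
      ∀ c : ℕ → Fin m, IsCoding F c x → ∃ p : ℕ, 1 ≤ p ∧ Function.Periodic c p) :
    (prebreakPoints F Λ).Finite := by
  have hfin : (⋃ x ∈ F.breakPoints ∩ Λ, ⋃ d ∈ {c : ℕ → Fin m | IsCoding F c x},
      Set.range fun j n => d (n + j)).Finite := by
    refine (F.finite_breakPoints.inter_of_left Λ).biUnion fun x hx => ?_
    obtain ⟨h1, h2⟩ := hbrk x hx.2 hx.1
    refine h1.biUnion fun d hd => ?_
    obtain ⟨p, hp, hper⟩ := h2 d hd
    exact hper.finite_shifts hp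
  have := F.nonempty_index
  choose! code hcode using fun (y : ℝ) (hy : y ∈ Λ) => hΛ.exists_coding hy
  refine Set.Finite.of_finite_image (f := code) (hfin.subset ?_) ?_
  · rintro _ ⟨y, ⟨hy, w, hw⟩, rfl⟩
    obtain ⟨d, hd, hcd⟩ := (hcode y hy).exists_append w
    simp only [Set.mem_iUnion]
    exact ⟨_, ⟨hw, hΛ.fw_mem w hy⟩, d, hd, w.length, hcd.symm⟩
  · intro x hx y hy hxy
    have hx' := hcode x hx.1
    rw [hxy] at hx'
    exact hx'.unique (hcode y hy.1)

end Coding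

section Backward

variable {m : ℕ} {F : CPLIFS m} {Λ : Set ℝ}

/-- The points of `I` that some `f_w` maps to `y`. -/
def backwardOrbit (F : CPLIFS m) (I : Set ℝ) (y : ℝ) : Set ℝ := {z ∈ I | ∃ w, fw F.f w z = y}

lemma backwardOrbit_subset (I : Set ℝ) (y : ℝ) :
    backwardOrbit F I y ⊆ {y} ∪ ⋃ k, ⋃ x ∈ {x | F.f k x = y}, backwardOrbit F I x := by
  rintro z ⟨hz, w, hw⟩
  cases w with
  | nil => exact Or.inl hw
  | cons k w =>
    refine Or.inr ?_
    simp only [Set.mem_iUnion]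
    exact ⟨k, fw F.f w z, hw, hz, w, rfl⟩

lemma IsAttractor.infDist_map_le (hΛ : IsAttractor F Λ) {c : ℝ} (hc : ∀ k i, |F.ρ k i| ≤ c)
    (k : Fin m) (z : ℝ) : Metric.infDist (F.f k z) Λ ≤ c * Metric.infDist z Λ := by
  obtain ⟨p, hp, h⟩ := hΛ.2.1.exists_infDist_eq_dist hΛ.1 z
  rw [h]
  exact (Metric.infDist_le_dist_of_mem (hΛ.map_mem k hp)).trans (F.abs_sub_le hc k z p)

lemma IsAttractor.finite_backwardOrbit (hΛ : IsAttractor F Λ) {I : Set ℝ}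
    (hI : Bornology.IsBounded I) {y : ℝ} (hy : y ∉ Λ) : (backwardOrbit F I y).Finite := by
  obtain ⟨c, hc0, hc1, hc⟩ := F.exists_contraction_ratio
  obtain ⟨p, hp⟩ := hΛ.1
  obtain ⟨R, hR0, hR⟩ := hI.subset_closedBall_lt 0 p
  have hIR : ∀ z ∈ I, Metric.infDist z Λ ≤ R := fun z hz =>
    (Metric.infDist_le_dist_of_mem hp).trans (Metric.mem_closedBall.1 (hR hz))
  have hfw : ∀ w z, Metric.infDist (fw F.f w z) Λ ≤ Metric.infDist z Λ := by
    intro w z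
    induction w with
    | nil => exact le_rfl
    | cons k w ih =>
      refine ((hΛ.infDist_map_le hc k _).trans ?_).trans ih
      exact mul_le_of_le_one_left Metric.infDist_nonneg hc1.le
  have key : ∀ n y, c ^ n * R < Metric.infDist y Λ → (backwardOrbit F I y).Finite := by
    intro n
    induction n with
    | zero =>
      intro y hy
      convert Set.finite_empty
      refine Set.eq_empty_of_forall_notMem ?_
      rintro z ⟨hz, w, rfl⟩
      have := hfw w z
      have := hIR z hz
      linarith
    | succ n ih =>
      intro y hy
      refine Set.Finite.subset ?_ (backwardOrbit_subset I y)
      refine (Set.finite_singleton y).union (Set.finite_iUnion fun k => ?_)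
      refine (F.finite_fiber k y).biUnion fun x hx => ih x ?_
      by_contra! hcon
      have h1 := hΛ.infDist_map_le hc k x
      rw [show F.f k x = y from hx] at h1
      have h2 := mul_le_mul_of_nonneg_left hcon hc0
      rw [pow_succ', mul_assoc] at hy
      linarith
  have hpos := (hΛ.2.1.isClosed.notMem_iff_infDist_pos ⟨p, hp⟩).1 hy
  obtain ⟨n, hn⟩ := exists_pow_lt_of_lt_one (div_pos hpos hR0) hc1
  exact key n y ((lt_div_iff₀ hR0).1 hn)

/-- If only finitely many points of the attractor are eventually mapped to breaking points, then
the breaking points can be completed to a finite set that contains all its preimages in `I`. -/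
lemma IsAttractor.exists_finite_backward_invariant (hΛ : IsAttractor F Λ)
    (hfin : (prebreakPoints F Λ).Finite) {I : Set ℝ} (hI : Bornology.IsBounded I) :
    ∃ D : Set ℝ, D.Finite ∧ F.breakPoints ⊆ D ∧ ∀ k, ∀ y ∈ I, F.f k y ∈ D → y ∈ D := by
  refine ⟨F.breakPoints ∪ ⋃ b ∈ F.breakPoints, backwardOrbit F I b,
    F.finite_breakPoints.union (F.finite_breakPoints.biUnion fun b hb => ?_),
    Set.subset_union_left, fun k y hy hky => Or.inr ?_⟩
  · by_cases hbΛ : b ∈ Λ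
    swap
    · exact hΛ.finite_backwardOrbit hI hbΛ
    have hU : (prebreakPoints F Λ ∪ ⋃ k, ⋃ a ∈ prebreakPoints F Λ, ⋃ x ∈ {x | F.f k x = a} \ Λ,
        backwardOrbit F I x).Finite := by
      refine hfin.union (Set.finite_iUnion fun k => hfin.biUnion fun a _ => ?_)
      exact ((F.finite_fiber k a).sdiff).biUnion fun x hx => hΛ.finite_backwardOrbit hI hx.2
    refine hU.subset ?_
    rintro z ⟨hz, w, hw⟩
    have hmem : fw F.f w z ∈ prebreakPoints F Λ := by
      rw [hw]
      exact ⟨hbΛ, [], hb⟩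
    clear hw
    induction w with
    | nil => exact Or.inl hmem
    | cons k w ih =>
      by_cases hx : fw F.f w z ∈ Λ
      · obtain ⟨-, v, hv⟩ := hmem
        refine ih ⟨hx, v ++ [k], ?_⟩
        rw [fw_append_singleton]
        exact hv
      · refine Or.inr ?_
        simp only [Set.mem_iUnion]
        exact ⟨k, _, hmem, fw F.f w z, ⟨rfl, hx⟩, hz, w, rfl⟩
  · simp only [Set.mem_iUnion]
    rcases hky with hky | hky
    · exact ⟨_, hky, hy, [k], rfl⟩
    · simp only [Set.mem_iUnion] at hky
      obtain ⟨b, hb, -, w, hw⟩ := hky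
      exact ⟨b, hb, hy, w ++ [k], by rw [fw_append_singleton, hw]⟩

end Backward

/-- The closed cell lying to the left of the points of `T` and to the right of the other points
of `D`. -/
def cell (D T : Set ℝ) : Set ℝ := {y | (∀ x ∈ T, y ≤ x) ∧ ∀ x ∈ D \ T, x ≤ y}

lemma isClosed_cell (D T : Set ℝ) : IsClosed (cell D T) := by
  have : cell D T = (⋂ x ∈ T, Set.Iic x) ∩ ⋂ x ∈ D \ T, Set.Ici x := by
    ext y
    simp [cell]
  rw [this]
  exact (isClosed_biInter fun _ _ => isClosed_Iic).inter (isClosed_biInter fun _ _ => isClosed_Ici)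

lemma oneSided_of_subset_cell {D T K : Set ℝ} (hK : K ⊆ cell D T) {x : ℝ} (hx : x ∈ D) :
    OneSided K x := by
  by_cases h : x ∈ T
  · exact Or.inl fun y hy => (hK hy).1 x h
  · exact Or.inr fun y hy => (hK hy).2 x ⟨hx, h⟩

lemma mem_cell_self (D : Set ℝ) (y : ℝ) : y ∈ cell D {x ∈ D | y ≤ x} :=
  ⟨fun _ hx => hx.2, fun _ hx => (not_le.1 fun h => hx.2 ⟨hx.1, h⟩).le⟩

lemma subset_cell_of_oneSided {D T K : Set ℝ} (hT : T ⊆ D) (hK : ∀ x ∈ D, OneSided K x) {y : ℝ}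
    (hyK : y ∈ K) (hyD : y ∉ D) (hy : y ∈ cell D T) : K ⊆ cell D T := by
  have hne : ∀ x ∈ D, y ≠ x := fun x hx h => hyD (h ▸ hx)
  refine fun z hz => ⟨fun x hx => ?_, fun x hx => ?_⟩
  · rcases hK x (hT hx) with h | h
    · exact h z hz
    · exact absurd (le_antisymm (hy.1 x hx) (h y hyK)) (hne x (hT hx))
  · rcases hK x hx.1 with h | h
    · exact absurd (le_antisymm (h y hyK) (hy.2 x hx)) (hne x hx.1)
    · exact h z hz

/-- A continuous map sends a subset of a cell to one side of each point of `D`, provided that `D`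
contains its own preimages in an interval around the subset. -/
lemma OneSided.image {D I K : Set ℝ} {g : ℝ → ℝ} (hg : Continuous g) (hI : I.OrdConnected)
    (hKI : K ⊆ I) (hD : ∀ y ∈ I, g y ∈ D → y ∈ D) (hK : ∀ x ∈ D, OneSided K x) {x : ℝ}
    (hx : x ∈ D) : OneSided (g '' K) x := by
  by_contra hcon
  simp only [OneSided, Set.forall_mem_image, not_or, not_forall, not_le] at hcon
  obtain ⟨⟨b, hb, hxb⟩, a, ha, hax⟩ := hcon
  obtain ⟨y, hy, rfl⟩ := intermediate_value_uIcc hg.continuousOn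
    (Set.Icc_subset_uIcc ⟨hax.le, hxb.le⟩)
  have hyD := hD y (hI.uIcc_subset (hKI ha) (hKI hb) hy) hx
  have hya : y ≠ a := by rintro rfl; exact lt_irrefl _ hax
  have hyb : y ≠ b := by rintro rfl; exact lt_irrefl _ hxb
  rcases Set.mem_uIcc.1 hy with ⟨h1, h2⟩ | ⟨h1, h2⟩ <;> rcases hK y hyD with h | h
  · exact hyb (le_antisymm h2 (h b hb))
  · exact hya (le_antisymm (h a ha) h1)
  · exact hya (le_antisymm h2 (h a ha))
  · exact hyb (le_antisymm (h b hb) h1)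

/-- A finite family of compact sets that are locally images of one another under maps `f k` that
are affine on them yields a self-similar graph-directed system. -/
lemma exists_graphDirected {m : ℕ} (F : CPLIFS m) {Λ : Set ℝ} {𝒦 : Set (Set ℝ)}
    (hfin : 𝒦.Finite) (hne : 𝒦.Nonempty) (hcpt : ∀ K ∈ 𝒦, K.Nonempty ∧ IsCompact K)
    (hΛ : Λ = ⋃₀ 𝒦) (haff : ∀ K ∈ 𝒦, ∀ x ∈ F.breakPoints, OneSided K x)
    (hcov : ∀ K ∈ 𝒦, ∀ y ∈ K, ∃ k, ∃ K₁ ∈ 𝒦, y ∈ F.f k '' K₁ ∧ F.f k '' K₁ ⊆ K) :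
    ∃ q : ℕ, 1 ≤ q ∧ ∃ Λs : Fin q → Set ℝ,
      (∀ i, (Λs i).Nonempty ∧ IsCompact (Λs i)) ∧
      Λ = ⋃ i, Λs i ∧
      ∃ (nE : ℕ) (src tgt : Fin nE → Fin q) (r t : Fin nE → ℝ),
        (∀ e, r e ≠ 0 ∧ |r e| < 1) ∧
        (∀ i : Fin q, Λs i = ⋃ e ∈ {e : Fin nE | src e = i},
          (fun x => r e * x + t e) '' Λs (tgt e)) ∧
        ∃ P : ℕ, 1 ≤ P ∧ ∀ e : Fin nE, ∃ w : List (Fin m), w.length = P ∧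
          ∀ x ∈ Λs (tgt e), r e * x + t e = fw F.f w x := by
  have := hfin.to_subtype
  have := hne.to_subtype
  obtain ⟨q, ⟨φ⟩⟩ := Finite.exists_equiv_fin 𝒦
  have hq : 1 ≤ q := Fin.pos_iff_nonempty.2 (φ.nonempty_congr.1 inferInstance)
  let Λs : Fin q → Set ℝ := fun i => (φ.symm i : Set ℝ)
  have hmem : ∀ i, Λs i ∈ 𝒦 := fun i => (φ.symm i).2
  have hsurj : ∀ K ∈ 𝒦, ∃ i, Λs i = K := fun K hK => ⟨φ ⟨K, hK⟩, by simp [Λs]⟩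
  obtain ⟨nE, ⟨ψ⟩⟩ := Finite.exists_equiv_fin
    {e : Fin q × Fin q × Fin m // F.f e.2.2 '' Λs e.2.1 ⊆ Λs e.1}
  choose r t hr hrt using fun (i : Fin q) (k : Fin m) => F.exists_affine k (haff _ (hmem i))
  refine ⟨q, hq, Λs, fun i => hcpt _ (hmem i), ?_, nE, fun e => (ψ.symm e).1.1,
    fun e => (ψ.symm e).1.2.1, fun e => r (ψ.symm e).1.2.1 (ψ.symm e).1.2.2,
    fun e => t (ψ.symm e).1.2.1 (ψ.symm e).1.2.2, fun e => hr _ _, fun i => ?_,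
    1, le_rfl, fun e => ⟨[(ψ.symm e).1.2.2], rfl, fun x hx => hrt _ _ x hx⟩⟩
  · rw [hΛ]
    ext y
    simp only [Set.mem_sUnion, Set.mem_iUnion]
    constructor
    · rintro ⟨K, hK, hy⟩
      obtain ⟨i, rfl⟩ := hsurj K hK
      exact ⟨i, hy⟩
    · rintro ⟨i, hy⟩
      exact ⟨_, hmem i, hy⟩
  · ext y
    simp only [Set.mem_iUnion, Set.mem_ofPred_eq]
    constructor
    · intro hy
      obtain ⟨k, K₁, hK₁, ⟨x, hx, hxy⟩, hsub⟩ := hcov _ (hmem i) y hy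
      obtain ⟨j, rfl⟩ := hsurj K₁ hK₁
      refine ⟨ψ ⟨(i, j, k), hsub⟩, by simp, x, by simpa using hx, ?_⟩
      simp only [Equiv.symm_apply_apply]
      rw [hrt j k x hx, hxy]
    · rintro ⟨e, rfl, x, hx, rfl⟩
      simp only
      rw [hrt _ _ x hx]
      exact (ψ.symm e).2 ⟨x, hx, rfl⟩

/-- If every breaking point of `F` lying on the attractor has only finitely
many codings, all of them periodic, then the attractor is the attractor of a self-similar
graph-directed iterated function system whose maps agree on the pieces with the `f_w`,
`w ∈ {1,…,m}^P`. -/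
theorem statement0 {m : ℕ} (F : CPLIFS m) (Λ : Set ℝ) (hΛ : IsAttractor F Λ)
    (hbrk : ∀ x ∈ Λ, IsBreakPoint F x →
      {c : ℕ → Fin m | IsCoding F c x}.Finite ∧
      ∀ c : ℕ → Fin m, IsCoding F c x → ∃ p : ℕ, 1 ≤ p ∧ Function.Periodic c p) :
    ∃ q : ℕ, 1 ≤ q ∧ ∃ Λs : Fin q → Set ℝ,
      (∀ i, (Λs i).Nonempty ∧ IsCompact (Λs i)) ∧
      Λ = ⋃ i, Λs i ∧
      ∃ (nE : ℕ) (src tgt : Fin nE → Fin q) (r t : Fin nE → ℝ),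
        (∀ e, r e ≠ 0 ∧ |r e| < 1) ∧
        (∀ i : Fin q, Λs i = ⋃ e ∈ {e : Fin nE | src e = i},
          (fun x => r e * x + t e) '' Λs (tgt e)) ∧
        ∃ P : ℕ, 1 ≤ P ∧ ∀ e : Fin nE, ∃ w : List (Fin m), w.length = P ∧
          ∀ x ∈ Λs (tgt e), r e * x + t e = fw F.f w x := by
  obtain ⟨a, ha⟩ := hΛ.2.1.bddBelow
  obtain ⟨b, hb⟩ := hΛ.2.1.bddAbove
  have hΛI : Λ ⊆ Set.Icc a b := fun x hx => ⟨ha hx, hb hx⟩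
  obtain ⟨D, hDfin, hbD, hD⟩ := hΛ.exists_finite_backward_invariant
    (hΛ.finite_prebreakPoints hbrk) (Metric.isBounded_Icc a b)
  set cells : Set (Set ℝ) := {K | K.Nonempty ∧ ∃ T ⊆ D, K = Λ ∩ cell D T}
  set points : Set (Set ℝ) := {K | ∃ x ∈ Λ ∩ D, K = {x}}
  have hcell_mem : ∀ z ∈ Λ, Λ ∩ cell D {x ∈ D | z ≤ x} ∈ cells := fun z hz =>
    ⟨⟨z, hz, mem_cell_self D z⟩, _, Set.sep_subset _ _, rfl⟩
  have hside : ∀ K ∈ cells ∪ points, ∀ x ∈ D, OneSided K x := by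
    rintro K (⟨-, T, -, rfl⟩ | ⟨z, -, rfl⟩) x hx
    · exact oneSided_of_subset_cell Set.inter_subset_right hx
    · exact oneSided_of_subset_cell (Set.singleton_subset_iff.2 (mem_cell_self D z)) hx
  refine exists_graphDirected F (𝒦 := cells ∪ points) ?_ ?_ ?_ ?_
    (fun K hK x hx => hside K hK x (hbD hx)) ?_
  · refine Set.Finite.union ?_ ?_
    · refine (hDfin.finite_subsets.image fun T => Λ ∩ cell D T).subset ?_
      rintro K ⟨-, T, hT, rfl⟩
      exact ⟨T, hT, rfl⟩
    · refine ((hDfin.inter_of_right Λ).image fun x => ({x} : Set ℝ)).subset ?_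
      rintro K ⟨x, hx, rfl⟩
      exact ⟨x, hx, rfl⟩
  · obtain ⟨z, hz⟩ := hΛ.1
    exact ⟨_, Or.inl (hcell_mem z hz)⟩
  · rintro K (⟨hne, T, -, rfl⟩ | ⟨z, -, rfl⟩)
    · exact ⟨hne, hΛ.2.1.inter_right (isClosed_cell D T)⟩
    · exact ⟨Set.singleton_nonempty z, isCompact_singleton⟩
  · refine Set.Subset.antisymm (fun z hz => ⟨_, Or.inl (hcell_mem z hz), hz, mem_cell_self D z⟩) ?_
    refine Set.sUnion_subset ?_
    rintro K (⟨-, T, -, rfl⟩ | ⟨z, hz, rfl⟩)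
    · exact Set.inter_subset_left
    · exact Set.singleton_subset_iff.2 hz.1
  · intro K hK y hy
    have hyΛ : y ∈ Λ := by
      rcases hK with ⟨-, T, -, rfl⟩ | ⟨z, hz, rfl⟩
      · exact hy.1
      · exact hy ▸ hz.1
    obtain ⟨k, z, hz, rfl⟩ := hΛ.exists_preimage hyΛ
    by_cases hyD : F.f k z ∈ D
    · refine ⟨k, {z}, Or.inr ⟨z, ⟨hz, hD k z (hΛI hz) hyD⟩, rfl⟩, ⟨z, rfl, rfl⟩, ?_⟩
      rintro _ ⟨x, rfl, rfl⟩
      exact hy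
    · rcases hK with ⟨-, T, hT, rfl⟩ | ⟨x, hx, rfl⟩
      swap
      · exact absurd (hy ▸ hx.2) hyD
      have hK₁ := hcell_mem z hz
      refine ⟨k, _, Or.inl hK₁, ⟨z, ⟨hz, mem_cell_self D z⟩, rfl⟩, Set.subset_inter ?_ ?_⟩
      · rintro _ ⟨x, hx, rfl⟩
        exact hΛ.map_mem k hx.1
      · refine subset_cell_of_oneSided hT (fun x hx => ?_) ⟨z, ⟨hz, mem_cell_self D z⟩, rfl⟩
          hyD hy.2
        exact OneSided.image (F.continuous_f k) Set.ordConnected_Icc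
          (Set.inter_subset_left.trans hΛI) (hD k) (hside _ (Or.inl hK₁)) hx
end
end

section
/- Under the three-map fixed-point-breaking hypotheses, set Λ_1 = f_1(Λ), Λ_2 = f_2(Λ) ∩ [0,φ_2], Λ_3 = f_2(Λ) ∩ [φ_2,1], Λ_4 = f_3(Λ), and define the similarities S_{2,1}(x) = ρ_2 x + φ_2(1−ρ_2) and S_{2,2}(x) = ρ_3 x + φ_2(1−ρ_3). Then Λ = Λ_1 ∪ Λ_2 ∪ Λ_3 ∪ Λ_4, and the graph-directed relations Λ_1 = f_1(Λ_1 ∪ Λ_2 ∪ Λ_3 ∪ Λ_4), Λ_2 = S_{2,1}(Λ_1 ∪ Λ_2), Λ_3 = S_{2,2}(Λ_3 ∪ Λ_4) and Λ_4 = f_3(Λ_1 ∪ Λ_2 ∪ Λ_3 ∪ Λ_4) hold. -/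
open Set

noncomputable section

/-- `f₁(x) = ρ₁ x`. -/
def mapOne (ρ1 : ℝ) (x : ℝ) : ℝ := ρ1 * x

/-- `f₂` breaks at its fixed point `φ₂`, with slope `ρ₂` on the left and `ρ₃` on the right. -/
def mapTwo (φ2 ρ2 ρ3 : ℝ) (x : ℝ) : ℝ :=
  if x ≤ φ2 then ρ2 * x + φ2 * (1 - ρ2) else ρ3 * x + φ2 * (1 - ρ3)

/-- `f₃(x) = ρ₄ x + (1 - ρ₄)`. -/
def mapThree (ρ4 : ℝ) (x : ℝ) : ℝ := ρ4 * x + (1 - ρ4)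

lemma mapTwo_of_le {φ2 x : ℝ} (ρ2 ρ3 : ℝ) (h : x ≤ φ2) :
    mapTwo φ2 ρ2 ρ3 x = ρ2 * x + φ2 * (1 - ρ2) := if_pos h

lemma mapTwo_of_ge {φ2 x : ℝ} (ρ2 ρ3 : ℝ) (h : φ2 ≤ x) :
    mapTwo φ2 ρ2 ρ3 x = ρ3 * x + φ2 * (1 - ρ3) := by
  rcases h.eq_or_lt with rfl | h
  · rw [mapTwo_of_le _ _ le_rfl]; ring
  · exact if_neg h.not_ge

lemma mapTwo_le_iff {φ2 ρ2 ρ3 x : ℝ} (h2 : 0 < ρ2) (h3 : 0 < ρ3) :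
    mapTwo φ2 ρ2 ρ3 x ≤ φ2 ↔ x ≤ φ2 := by
  refine ⟨fun h => ?_, fun h => ?_⟩
  · by_contra! hx
    rw [mapTwo_of_ge _ _ hx.le] at h
    nlinarith [mul_pos h3 (sub_pos.2 hx)]
  · rw [mapTwo_of_le _ _ h]
    nlinarith [mul_nonneg h2.le (sub_nonneg.2 h)]

lemma le_mapTwo_iff {φ2 ρ2 ρ3 x : ℝ} (h2 : 0 < ρ2) (h3 : 0 < ρ3) :
    φ2 ≤ mapTwo φ2 ρ2 ρ3 x ↔ φ2 ≤ x := by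
  refine ⟨fun h => ?_, fun h => ?_⟩
  · by_contra! hx
    rw [mapTwo_of_le _ _ hx.le] at h
    nlinarith [mul_pos h2 (sub_pos.2 hx)]
  · rw [mapTwo_of_ge _ _ h]
    nlinarith [mul_nonneg h3.le (sub_nonneg.2 h)]

/-- A compact set covered by its images under the three maps lies in `[0,1]`. -/
lemma subset_Icc_of_subset_images {φ2 ρ1 ρ2 ρ3 ρ4 : ℝ} (hφ : φ2 ∈ Ioo (0:ℝ) 1)
    (h1 : ρ1 ∈ Ioo (0:ℝ) 1) (h2 : ρ2 ∈ Ioo (0:ℝ) 1)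
    (h3 : ρ3 ∈ Ioo (0:ℝ) 1) (h4 : ρ4 ∈ Ioo (0:ℝ) 1)
    {Λ : Set ℝ} (hΛc : IsCompact Λ)
    (hatt : Λ ⊆ mapOne ρ1 '' Λ ∪ mapTwo φ2 ρ2 ρ3 '' Λ ∪ mapThree ρ4 '' Λ) :
    Λ ⊆ Icc 0 1 := by
  obtain ⟨hφ0, hφ1⟩ := hφ
  obtain ⟨h10, h11⟩ := h1
  obtain ⟨h20, h21⟩ := h2
  obtain ⟨h30, h31⟩ := h3
  obtain ⟨h40, h41⟩ := h4
  rcases Λ.eq_empty_or_nonempty with rfl | hne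
  · exact empty_subset _
  obtain ⟨m, hm, hmin⟩ := hΛc.exists_isLeast hne
  obtain ⟨M, hM, hmax⟩ := hΛc.exists_isGreatest hne
  have hm0 : 0 ≤ m := by
    by_contra! hneg
    rcases hatt hm with (⟨x, hx, e⟩ | ⟨x, hx, e⟩) | ⟨x, hx, e⟩
    · have := hmin hx
      unfold mapOne at e
      nlinarith
    · have := hmin hx
      have hxφ : x ≤ φ2 := (mapTwo_le_iff h20 h30).1 (by linarith)
      rw [mapTwo_of_le _ _ hxφ] at e
      nlinarith
    · have := hmin hx
      unfold mapThree at e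
      nlinarith
  have hM1 : M ≤ 1 := by
    by_contra! hgt
    rcases hatt hM with (⟨x, hx, e⟩ | ⟨x, hx, e⟩) | ⟨x, hx, e⟩
    · have := hmax hx
      unfold mapOne at e
      nlinarith
    · have := hmax hx
      have hxφ : φ2 ≤ x := (le_mapTwo_iff h20 h30).1 (by linarith)
      rw [mapTwo_of_ge _ _ hxφ] at e
      nlinarith
    · have := hmax hx
      unfold mapThree at e
      nlinarith
  exact fun x hx => ⟨hm0.trans (hmin hx), (hmax hx).trans hM1⟩

/-- Under the three-map fixed-point-breaking hypotheses, with
`Λ₁ = f₁(Λ)`, `Λ₂ = f₂(Λ) ∩ [0,φ₂]`, `Λ₃ = f₂(Λ) ∩ [φ₂,1]`, `Λ₄ = f₃(Λ)` and the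
similarities `S₂₁(x) = ρ₂x + φ₂(1-ρ₂)`, `S₂₂(x) = ρ₃x + φ₂(1-ρ₃)`, we have
`Λ = Λ₁ ∪ Λ₂ ∪ Λ₃ ∪ Λ₄` together with the graph-directed relations. -/
theorem statement2 (φ2 ρ1 ρ2 ρ3 ρ4 : ℝ)
    (hφ : φ2 ∈ Ioo (0:ℝ) 1)
    (h1 : ρ1 ∈ Ioo (0:ℝ) 1) (h2 : ρ2 ∈ Ioo (0:ℝ) 1)
    (h3 : ρ3 ∈ Ioo (0:ℝ) 1) (h4 : ρ4 ∈ Ioo (0:ℝ) 1)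
    (hne : ρ2 ≠ ρ3)
    (hd1 : ρ1 < φ2 * (1 - ρ2)) (hd2 : φ2 + ρ3 * (1 - φ2) < 1 - ρ4)
    (Λ : Set ℝ) (hΛne : Λ.Nonempty) (hΛc : IsCompact Λ)
    (hatt : Λ = mapOne ρ1 '' Λ ∪ mapTwo φ2 ρ2 ρ3 '' Λ ∪ mapThree ρ4 '' Λ)
    (Λ1 Λ2 Λ3 Λ4 : Set ℝ)
    (hΛ1 : Λ1 = mapOne ρ1 '' Λ)
    (hΛ2 : Λ2 = mapTwo φ2 ρ2 ρ3 '' Λ ∩ Icc 0 φ2)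
    (hΛ3 : Λ3 = mapTwo φ2 ρ2 ρ3 '' Λ ∩ Icc φ2 1)
    (hΛ4 : Λ4 = mapThree ρ4 '' Λ)
    (S21 S22 : ℝ → ℝ)
    (hS21 : ∀ x, S21 x = ρ2 * x + φ2 * (1 - ρ2))
    (hS22 : ∀ x, S22 x = ρ3 * x + φ2 * (1 - ρ3)) :
    Λ = Λ1 ∪ Λ2 ∪ Λ3 ∪ Λ4 ∧
    Λ1 = mapOne ρ1 '' (Λ1 ∪ Λ2 ∪ Λ3 ∪ Λ4) ∧
    Λ2 = S21 '' (Λ1 ∪ Λ2) ∧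
    Λ3 = S22 '' (Λ3 ∪ Λ4) ∧
    Λ4 = mapThree ρ4 '' (Λ1 ∪ Λ2 ∪ Λ3 ∪ Λ4) := by
  have hsub : Λ ⊆ Icc 0 1 := subset_Icc_of_subset_images hφ h1 h2 h3 h4 hΛc hatt.subset
  obtain ⟨hφ0, hφ1⟩ := hφ
  obtain ⟨h10, h11⟩ := h1
  obtain ⟨h20, h21⟩ := h2
  obtain ⟨h30, h31⟩ := h3
  obtain ⟨h40, h41⟩ := h4
  have hU : Λ = Λ1 ∪ Λ2 ∪ Λ3 ∪ Λ4 := by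
    have h23 : mapTwo φ2 ρ2 ρ3 '' Λ = Λ2 ∪ Λ3 := by
      rw [hΛ2, hΛ3, ← inter_union_distrib_left, Icc_union_Icc_eq_Icc hφ0.le hφ1.le]
      refine (inter_eq_left.2 fun y hy => hsub ?_).symm
      rw [hatt]
      exact Or.inl (Or.inr hy)
    rw [union_assoc Λ1, ← h23, hΛ1, hΛ4]
    exact hatt
  have hle1 : ∀ y ∈ Λ1, y < φ2 := by
    rw [hΛ1]
    rintro _ ⟨x, hx, rfl⟩
    have := hsub hx
    unfold mapOne
    nlinarith [this.1, this.2]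
  have hge4 : ∀ y ∈ Λ4, φ2 < y := by
    rw [hΛ4]
    rintro _ ⟨x, hx, rfl⟩
    have := hsub hx
    unfold mapThree
    nlinarith [this.1, this.2, mul_nonneg h40.le this.1]
  have hfix : mapTwo φ2 ρ2 ρ3 φ2 = φ2 := by
    rw [mapTwo_of_le _ _ le_rfl]; ring
  have hleft : Λ1 ∪ Λ2 = Λ ∩ Iic φ2 := by
    ext y
    constructor
    · rintro (hy | hy)
      · exact ⟨by rw [hU]; simp [hy], (hle1 y hy).le⟩
      · exact ⟨by rw [hU]; simp [hy], by rw [hΛ2] at hy; exact hy.2.2⟩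
    · rintro ⟨hy, hyφ : y ≤ φ2⟩
      have hy' := hy
      rw [hU] at hy'
      rcases hy' with (h | h) | h
      · exact h
      · have hyeq : y = φ2 := le_antisymm hyφ (by rw [hΛ3] at h; exact h.2.1)
        subst hyeq
        right
        rw [hΛ2]
        exact ⟨⟨y, hy, hfix⟩, hφ0.le, le_rfl⟩
      · exact absurd (hge4 y h) hyφ.not_gt
  have hright : Λ3 ∪ Λ4 = Λ ∩ Ici φ2 := by
    ext y
    constructor
    · rintro (hy | hy)
      · exact ⟨by rw [hU]; simp [hy], by rw [hΛ3] at hy; exact hy.2.1⟩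
      · exact ⟨by rw [hU]; simp [hy], (hge4 y hy).le⟩
    · rintro ⟨hy, hyφ : φ2 ≤ y⟩
      have hy' := hy
      rw [hU] at hy'
      rcases hy' with ((h | h) | h) | h
      · exact absurd (hle1 y h) hyφ.not_gt
      · have hyeq : y = φ2 := le_antisymm (by rw [hΛ2] at h; exact h.2.2) hyφ
        subst hyeq
        left
        rw [hΛ3]
        exact ⟨⟨y, hy, hfix⟩, le_rfl, hφ1.le⟩
      · exact Or.inl h
      · exact Or.inr h
  have hmaps : ∀ x ∈ Λ, mapTwo φ2 ρ2 ρ3 x ∈ Icc (0:ℝ) 1 := fun x hx => hsub <| by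
    rw [hatt]
    exact Or.inl (Or.inr ⟨x, hx, rfl⟩)
  refine ⟨hU, hU ▸ hΛ1, ?_, ?_, hU ▸ hΛ4⟩
  · rw [hleft, hΛ2]
    ext y
    constructor
    · rintro ⟨⟨x, hx, rfl⟩, -, hxφ⟩
      have hxφ := (mapTwo_le_iff h20 h30).1 hxφ
      exact ⟨x, ⟨hx, hxφ⟩, by rw [hS21, mapTwo_of_le _ _ hxφ]⟩
    · rintro ⟨x, ⟨hx, hxφ⟩, rfl⟩
      rw [hS21, ← mapTwo_of_le ρ2 ρ3 hxφ]
      exact ⟨⟨x, hx, rfl⟩, (hmaps x hx).1, (mapTwo_le_iff h20 h30).2 hxφ⟩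
  · rw [hright, hΛ3]
    ext y
    constructor
    · rintro ⟨⟨x, hx, rfl⟩, hxφ, -⟩
      have hxφ := (le_mapTwo_iff h20 h30).1 hxφ
      exact ⟨x, ⟨hx, hxφ⟩, by rw [hS22, mapTwo_of_ge _ _ hxφ]⟩
    · rintro ⟨x, ⟨hx, hxφ⟩, rfl⟩
      rw [hS22, ← mapTwo_of_ge ρ2 ρ3 hxφ]
      exact ⟨⟨x, hx, rfl⟩, (le_mapTwo_iff h20 h30).2 hxφ, (hmaps x hx).2⟩
end
end

section
/- For every n ≥ 2, every s ∈ ℝ and all parameters ρ_1, …, ρ_{2n+2} ∈ (0,1), the determinants defined from these parameters satisfy the recursion Q_{2n+2}(s) = (1 − ρ_{2n+2}^s − ρ_{2n+1}^s)·Q_{2n}(s) + ρ_{2n+2}^s·Σ_{i=1}^{2n} (−1)^i Q_{2n,i}(s), where Q_{2n+2} is built from ρ_1,…,ρ_{2n+2} and Q_{2n}, Q_{2n,i} are built from ρ_1,…,ρ_{2n}. -/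
open Matrix

noncomputable section

/-- The 0/1 incidence pattern `χ_N(i,j)` (1-based indices): `χ_N(i,j) = 1` iff `i = 1`, or
`i = N`, or `i` is even and `j ≤ i`, or `i` is odd with `1 < i < N` and `i ≤ j`. -/
def chi (N i j : ℕ) : ℝ :=
  if i = 1 ∨ i = N ∨ (i % 2 = 0 ∧ j ≤ i) ∨ (i % 2 = 1 ∧ 1 < i ∧ i < N ∧ i ≤ j) then 1 else 0

/-- The `2n × 2n` matrix `C^{(s)}_{2n}` with entries `ρ_i^s · χ_{2n}(i,j) − δ_{ij}`
(1-based indices, built from `ρ 1, …, ρ (2n)`). -/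
def Cmat (n : ℕ) (ρ : ℕ → ℝ) (s : ℝ) : Matrix (Fin (2 * n)) (Fin (2 * n)) ℝ :=
  Matrix.of fun i j : Fin (2 * n) =>
    ρ ((i : ℕ) + 1) ^ s * chi (2 * n) ((i : ℕ) + 1) ((j : ℕ) + 1) -
      if i = j then 1 else 0

/-- `Q_{2n}(s) = det C^{(s)}_{2n}`. -/
def Qdet (n : ℕ) (ρ : ℕ → ℝ) (s : ℝ) : ℝ := (Cmat n ρ s).det

/-- Index of the old (0-based) column corresponding to the new (0-based) column `c` after
deleting the (1-based) column `i`. -/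
def colIdx (i c : ℕ) : ℕ := if c + 1 < i then c else c + 1

/-- `Q_{2n,i}(s)`: the determinant of the matrix obtained from `C^{(s)}_{2n}` by deleting its
`i`-th column (1-based) and appending on the right the column `v` with `v_j = ρ_j^s` for odd
`j` and `v_j = 0` for even `j` (1-based). -/
def Qdel (n : ℕ) (ρ : ℕ → ℝ) (s : ℝ) (i : ℕ) : ℝ :=
  Matrix.det (Matrix.of fun r c : Fin (2 * n) =>
    if hc : (c : ℕ) + 1 < 2 * n then
      Cmat n ρ s r ⟨colIdx i (c : ℕ), by unfold colIdx; split <;> omega⟩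
    else if ((r : ℕ) + 1) % 2 = 1 then ρ ((r : ℕ) + 1) ^ s else 0)

/-- The column `v` with `v_j = ρ_j^s` for odd `j` and `v_j = 0` for even `j` (1-based). -/
def oddCol (n : ℕ) (ρ : ℕ → ℝ) (s : ℝ) (r : Fin (2 * n)) : ℝ :=
  if ((r : ℕ) + 1) % 2 = 1 then ρ ((r : ℕ) + 1) ^ s else 0

/-- The matrix `C^{(s)}_{2n}` bordered by the column `oddCol` on the right, by a constant row
`b` below, and with corner entry `x`. -/
def bordered (n : ℕ) (ρ : ℕ → ℝ) (s b x : ℝ) : Matrix (Fin (2 * n + 1)) (Fin (2 * n + 1)) ℝ :=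
  Matrix.of fun i j =>
    Fin.lastCases (motive := fun _ => ℝ)
      (Fin.lastCases (motive := fun _ => ℝ) x (fun _ => b) j)
      (fun r => Fin.lastCases (motive := fun _ => ℝ) (oddCol n ρ s r) (fun c => Cmat n ρ s r c) j)
      i

@[simp] lemma bordered_last_last (n : ℕ) (ρ : ℕ → ℝ) (s b x : ℝ) :
    bordered n ρ s b x (Fin.last _) (Fin.last _) = x := by simp [bordered]

@[simp] lemma bordered_last_castSucc (n : ℕ) (ρ : ℕ → ℝ) (s b x : ℝ) (c : Fin (2 * n)) :
    bordered n ρ s b x (Fin.last _) c.castSucc = b := by simp [bordered]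

@[simp] lemma bordered_castSucc_last (n : ℕ) (ρ : ℕ → ℝ) (s b x : ℝ) (r : Fin (2 * n)) :
    bordered n ρ s b x r.castSucc (Fin.last _) = oddCol n ρ s r := by simp [bordered]

@[simp] lemma bordered_castSucc_castSucc (n : ℕ) (ρ : ℕ → ℝ) (s b x : ℝ) (r c : Fin (2 * n)) :
    bordered n ρ s b x r.castSucc c.castSucc = Cmat n ρ s r c := by simp [bordered]

/-- Deleting the last row and the column of `C` with 0-based index `j` from the bordered matrix
leaves the matrix defining `Q_{2n,j+1}`. -/
lemma det_bordered_minor (n : ℕ) (ρ : ℕ → ℝ) (s b x : ℝ) (j : Fin (2 * n)) :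
    ((bordered n ρ s b x).submatrix Fin.castSucc j.castSucc.succAbove).det =
      Qdel n ρ s (j + 1) := by
  unfold Qdel
  congr 1
  ext r c
  simp only [submatrix_apply, of_apply]
  split_ifs with hc hr
  · have h : j.castSucc.succAbove c =
        Fin.castSucc ⟨colIdx (j + 1) c, by unfold colIdx; split <;> omega⟩ := by
      ext
      simp only [Fin.succAbove, colIdx, Fin.lt_def, Fin.val_castSucc]
      split_ifs <;> simp <;> omega
    rw [h, bordered_castSucc_castSucc]
  all_goals
    have h : j.castSucc.succAbove c = Fin.last _ := by
      ext
      simp only [Fin.succAbove, Fin.lt_def, Fin.val_castSucc]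
      split_ifs <;> simp <;> omega
    rw [h, bordered_castSucc_last]
    simp [oddCol, hr]

/-- Laplace expansion of the bordered determinant along its last row. -/
lemma det_bordered (n : ℕ) (ρ : ℕ → ℝ) (s b x : ℝ) :
    (bordered n ρ s b x).det =
      x * Qdet n ρ s - b * ∑ i ∈ Finset.Icc 1 (2 * n), (-1 : ℝ) ^ i * Qdel n ρ s i := by
  have hsum : ∑ i ∈ Finset.Icc 1 (2 * n), (-1 : ℝ) ^ i * Qdel n ρ s i =
      ∑ j : Fin (2 * n), (-1 : ℝ) ^ ((j : ℕ) + 1) * Qdel n ρ s (j + 1) := by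
    rw [Fin.sum_univ_eq_sum_range (fun j => (-1 : ℝ) ^ (j + 1) * Qdel n ρ s (j + 1)),
      Finset.range_eq_Ico, Finset.sum_Ico_add' (fun i => (-1 : ℝ) ^ i * Qdel n ρ s i) 0 (2 * n) 1]
    rfl
  have hC : (bordered n ρ s b x).submatrix Fin.castSucc Fin.castSucc = Cmat n ρ s := by
    ext r c
    simp
  rw [det_succ_row _ (Fin.last _), Fin.sum_univ_castSucc, hsum, Finset.mul_sum]
  simp only [Fin.succAbove_last, det_bordered_minor, hC, bordered_last_last,
    bordered_last_castSucc, Fin.val_last, Fin.val_castSucc, pow_add, pow_mul, Qdet]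
  norm_num
  rw [add_comm]
  congr 1
  exact Finset.sum_congr rfl fun j _ => by ring

/-- Deleting row `2n+1` and one of the last two columns of `C^{(s)}_{2n+2}` leaves a bordered
matrix. -/
lemma Cmat_succ_minor (n : ℕ) (ρ : ℕ → ℝ) (s : ℝ) (k : Fin (2 * n + 2))
    (hk : 2 * n ≤ (k : ℕ)) :
    (Cmat (n + 1) ρ s : Matrix (Fin (2 * n + 2)) (Fin (2 * n + 2)) ℝ).submatrix
        (Fin.last (2 * n)).castSucc.succAbove k.succAbove =
      bordered n ρ s (ρ (2 * n + 2) ^ s)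
        (ρ (2 * n + 2) ^ s - if (k : ℕ) = 2 * n then 1 else 0) := by
  have hcol (c : Fin (2 * n)) : ((k.succAbove c.castSucc : Fin (2 * n + 2)) : ℕ) = c := by
    simp only [Fin.succAbove, Fin.lt_def, Fin.val_castSucc]
    split_ifs <;> simp <;> omega
  have hlast : ((k.succAbove (Fin.last _) : Fin (2 * n + 2)) : ℕ) =
      if (k : ℕ) = 2 * n then 2 * n + 1 else 2 * n := by
    simp only [Fin.succAbove, Fin.lt_def, Fin.val_castSucc, Fin.val_last]
    split_ifs <;> simp <;> omega
  have hrow (r : Fin (2 * n)) :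
      (((Fin.last (2 * n)).castSucc.succAbove r.castSucc : Fin (2 * n + 2)) : ℕ) = r := by
    simp [Fin.succAbove, Fin.lt_def]
  have hrowlast :
      (((Fin.last (2 * n)).castSucc.succAbove (Fin.last _) : Fin (2 * n + 2)) : ℕ) =
        2 * n + 1 := by
    simp [Fin.succAbove]
  ext i j
  induction i using Fin.lastCases with
  | last =>
    induction j using Fin.lastCases with
    | last =>
      rw [bordered_last_last]
      simp only [submatrix_apply, Cmat, of_apply, Fin.ext_iff, hrowlast, hlast, chi]
      split_ifs <;> grind
    | cast c =>
      rw [bordered_last_castSucc]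
      simp only [submatrix_apply, Cmat, of_apply, Fin.ext_iff, hrowlast, hcol, chi]
      split_ifs <;> grind
  | cast r =>
    induction j using Fin.lastCases with
    | last =>
      rw [bordered_castSucc_last]
      simp only [submatrix_apply, Cmat, of_apply, Fin.ext_iff, hrow, hlast, chi, oddCol]
      split_ifs <;> grind
    | cast c =>
      rw [bordered_castSucc_castSucc]
      simp only [submatrix_apply, Cmat, of_apply, Fin.ext_iff, hrow, hcol, chi]
      split_ifs <;> grind

/-- The row of `C^{(s)}_{2n+2}` with 1-based index `2n+1`. -/
lemma Cmat_succ_row (n : ℕ) (hn : 1 ≤ n) (ρ : ℕ → ℝ) (s : ℝ) (j : Fin (2 * n + 2)) :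
    (Cmat (n + 1) ρ s : Matrix (Fin (2 * n + 2)) (Fin (2 * n + 2)) ℝ)
        (Fin.last (2 * n)).castSucc j =
      if (j : ℕ) < 2 * n then 0
      else ρ (2 * n + 1) ^ s - if (j : ℕ) = 2 * n then 1 else 0 := by
  simp only [Cmat, of_apply, Fin.ext_iff, chi, Fin.val_castSucc, Fin.val_last]
  split_ifs <;> grind

/-- The recursion
`Q_{2n+2}(s) = (1 − ρ_{2n+2}^s − ρ_{2n+1}^s) Q_{2n}(s) + ρ_{2n+2}^s Σ_{i=1}^{2n} (−1)^i Q_{2n,i}(s)`. -/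
theorem statement4 (n : ℕ) (hn : 2 ≤ n) (s : ℝ) (ρ : ℕ → ℝ)
    (hρ : ∀ i : ℕ, 1 ≤ i → i ≤ 2 * n + 2 → ρ i ∈ Set.Ioo (0:ℝ) 1) :
    Qdet (n + 1) ρ s =
      (1 - ρ (2 * n + 2) ^ s - ρ (2 * n + 1) ^ s) * Qdet n ρ s +
        ρ (2 * n + 2) ^ s * ∑ i ∈ Finset.Icc 1 (2 * n), (-1 : ℝ) ^ i * Qdel n ρ s i := by
  have hn1 : 1 ≤ n := by omega
  have hdet : Qdet (n + 1) ρ s =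
      (Cmat (n + 1) ρ s : Matrix (Fin (2 * n + 2)) (Fin (2 * n + 2)) ℝ).det := rfl
  rw [hdet, det_succ_row _ (Fin.last (2 * n)).castSucc, Fin.sum_univ_castSucc,
    Fin.sum_univ_castSucc]
  simp only [Cmat_succ_row n hn1]
  rw [Cmat_succ_minor n ρ s (Fin.last (2 * n)).castSucc (by simp),
    Cmat_succ_minor n ρ s (Fin.last (2 * n + 1)) (by simp)]
  simp only [det_bordered, Fin.val_castSucc, Fin.val_last, Fin.is_lt, if_true, mul_zero,
    zero_mul, Finset.sum_const_zero, lt_irrefl, if_false, pow_add, pow_mul]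
  norm_num
  ring
end
end

section
/- For every n ≥ 2, every s ∈ ℝ and all parameters ρ_1, …, ρ_{2n+2} ∈ (0,1): Q_{2n+2,i}(s) = (1 − ρ_{2n+2}^s)·Q_{2n,i}(s) for every 1 ≤ i ≤ 2n; Q_{2n+2,2n+1}(s) = ρ_{2n+1}^s·(1 − ρ_{2n+2}^s)·Q_{2n}(s); and Q_{2n+2,2n+2}(s) = ρ_{2n+2}^s·(Σ_{j=1}^{2n} (−1)^j Q_{2n,j}(s) − ρ_{2n+1}^s·Q_{2n}(s)), where Q_{2n+2,i} is built from ρ_1,…,ρ_{2n+2} and Q_{2n}, Q_{2n,j} are built from ρ_1,…,ρ_{2n}. -/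
open Matrix

noncomputable section

/-- The determinant of the leading `N × N` block of an infinite array. -/
def leadingDet (N : ℕ) (f : ℕ → ℕ → ℝ) : ℝ :=
  Matrix.det (Matrix.of fun r c : Fin N => f r c)

theorem leadingDet_congr {N : ℕ} {f g : ℕ → ℕ → ℝ}
    (h : ∀ r < N, ∀ c < N, f r c = g r c) : leadingDet N f = leadingDet N g := by
  unfold leadingDet
  congr 1
  ext r c
  exact h r r.2 c c.2

theorem leadingDet_succ_row (N : ℕ) (f : ℕ → ℕ → ℝ) :
    leadingDet (N + 1) f = ∑ j ∈ Finset.range (N + 1), (-1 : ℝ) ^ (N + j) * f N j *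
      leadingDet N (fun r c => f r (if c < j then c else c + 1)) := by
  unfold leadingDet
  rw [Matrix.det_succ_row _ (Fin.last N), Finset.sum_range]
  refine Finset.sum_congr rfl fun j _ => ?_
  simp only [Matrix.of_apply, Fin.val_last]
  congr 2
  ext r c
  simp only [Matrix.submatrix_apply, Matrix.of_apply, Fin.succAbove_last, Fin.val_castSucc]
  congr 1
  simp only [Fin.succAbove, Fin.lt_def, Fin.val_castSucc]
  split_ifs <;> simp

theorem leadingDet_transpose (N : ℕ) (f : ℕ → ℕ → ℝ) :
    leadingDet N (fun r c => f c r) = leadingDet N f := by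
  unfold leadingDet
  rw [← Matrix.det_transpose]
  rfl

theorem leadingDet_succ_column (N : ℕ) (f : ℕ → ℕ → ℝ) :
    leadingDet (N + 1) f = ∑ j ∈ Finset.range (N + 1), (-1 : ℝ) ^ (N + j) * f j N *
      leadingDet N (fun r c => f (if r < j then r else r + 1) c) := by
  rw [← leadingDet_transpose, leadingDet_succ_row]
  refine Finset.sum_congr rfl fun j _ => ?_
  rw [← leadingDet_transpose]

theorem leadingDet_succ_of_row_eq_zero {N : ℕ} {f : ℕ → ℕ → ℝ}
    (h : ∀ c < N, f N c = 0) : leadingDet (N + 1) f = f N N * leadingDet N f := by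
  rw [leadingDet_succ_row, Finset.sum_range_succ, Finset.sum_eq_zero, zero_add,
    (Even.add_self N).neg_one_pow, one_mul]
  · congr 1
    exact leadingDet_congr fun r _ c hc => by rw [if_pos hc]
  · intro j hj
    rw [h j (Finset.mem_range.1 hj)]
    ring

theorem leadingDet_succ_of_column_eq_zero {N : ℕ} {f : ℕ → ℕ → ℝ}
    (h : ∀ r < N, f r N = 0) : leadingDet (N + 1) f = f N N * leadingDet N f := by
  rw [← leadingDet_transpose, leadingDet_succ_of_row_eq_zero h, leadingDet_transpose]

/-- Expansion along the last column when only its two bottom entries may be nonzero. -/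
theorem leadingDet_add_two_of_column_eq_zero {N : ℕ} {f : ℕ → ℕ → ℝ}
    (h : ∀ r < N, f r (N + 1) = 0) :
    leadingDet (N + 2) f = f (N + 1) (N + 1) * leadingDet (N + 1) f -
      f N (N + 1) * leadingDet (N + 1) (fun r c => f (if r < N then r else r + 1) c) := by
  rw [leadingDet_succ_column, Finset.sum_range_succ, Finset.sum_range_succ,
    Finset.sum_eq_zero, (Even.add_self (N + 1)).neg_one_pow,
    (show Odd (N + 1 + N) from ⟨N, by ring⟩).neg_one_pow]
  · rw [leadingDet_congr (N := N + 1) (g := f)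
      (f := fun r c => f (if r < N + 1 then r else r + 1) c) fun r hr c _ => by rw [if_pos hr]]
    ring
  · intro j hj
    rw [h j (Finset.mem_range.1 hj)]
    ring

/-- Subtracting the preceding column from the last one does not change the determinant. -/
theorem leadingDet_sub_column (N : ℕ) (f : ℕ → ℕ → ℝ) :
    leadingDet (N + 2) (fun r c => if c = N + 1 then f r (N + 1) - f r N else f r c) =
      leadingDet (N + 2) f := by
  unfold leadingDet
  rw [← Matrix.det_updateCol_add_smul_self (Matrix.of fun r c : Fin (N + 2) => f r c)
    (i := Fin.last (N + 1)) (j := (Fin.last N).castSucc) (Fin.castSucc_lt_last _).ne' (-1)]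
  congr 1
  ext r c
  rw [Matrix.updateCol_apply]
  by_cases hc : c = Fin.last (N + 1)
  · subst hc
    simp [sub_eq_add_neg]
  · have : (c : ℕ) ≠ N + 1 := fun e => hc (Fin.ext e)
    simp [hc, this]

/-- The entries of `Cmat`, indexed from zero by natural numbers. -/
def cEntry (n : ℕ) (ρ : ℕ → ℝ) (s : ℝ) (r c : ℕ) : ℝ :=
  ρ (r + 1) ^ s * chi (2 * n) (r + 1) (c + 1) - if r = c then 1 else 0

/-- The entries of the column appended in `Qdel`, indexed from zero. -/
def oddColumn (ρ : ℕ → ℝ) (s : ℝ) (r : ℕ) : ℝ :=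
  if (r + 1) % 2 = 1 then ρ (r + 1) ^ s else 0

/-- The entries of the matrix defining `Qdel`, indexed from zero by natural numbers. -/
def delEntry (n : ℕ) (ρ : ℕ → ℝ) (s : ℝ) (i r c : ℕ) : ℝ :=
  if c + 1 < 2 * n then cEntry n ρ s r (colIdx i c) else oddColumn ρ s r

theorem Qdet_eq_leadingDet (n : ℕ) (ρ : ℕ → ℝ) (s : ℝ) :
    Qdet n ρ s = leadingDet (2 * n) (cEntry n ρ s) := by
  unfold Qdet leadingDet
  congr 1
  ext r c
  simp [Cmat, cEntry, Fin.ext_iff]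

theorem Qdel_eq_leadingDet (n : ℕ) (ρ : ℕ → ℝ) (s : ℝ) (i : ℕ) :
    Qdel n ρ s i = leadingDet (2 * n) (delEntry n ρ s i) := by
  unfold Qdel leadingDet
  congr 1
  ext r c
  simp only [Cmat, cEntry, delEntry, oddColumn, Fin.ext_iff, Matrix.of_apply]
  split_ifs <;> rfl

section Entries

variable {n : ℕ} (ρ : ℕ → ℝ) (s : ℝ)

theorem cEntry_succ_of_lt {r c : ℕ} (hr : r < 2 * n) (hc : c < 2 * n) :
    cEntry (n + 1) ρ s r c = cEntry n ρ s r c := by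
  unfold cEntry chi
  congr 2
  refine if_congr ?_ rfl rfl
  omega

theorem cEntry_succ_of_le {r c : ℕ} (hr : r < 2 * n) (hc : 2 * n ≤ c) :
    cEntry (n + 1) ρ s r c = oddColumn ρ s r := by
  unfold cEntry chi oddColumn
  rw [if_neg (show r ≠ c by omega), sub_zero]
  by_cases h : (r + 1) % 2 = 1
  · rw [if_pos h, if_pos (by omega), mul_one]
  · rw [if_neg h, if_neg (by omega), mul_zero]

theorem cEntry_penultimate_row {c : ℕ} (hn : 1 ≤ n) :
    cEntry (n + 1) ρ s (2 * n) c =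
      (if 2 * n ≤ c then ρ (2 * n + 1) ^ s else 0) - if 2 * n = c then 1 else 0 := by
  unfold cEntry chi
  congr 1
  by_cases h : 2 * n ≤ c
  · rw [if_pos h, if_pos (by omega), mul_one]
  · rw [if_neg h, if_neg (by omega), mul_zero]

theorem cEntry_last_row {c : ℕ} :
    cEntry (n + 1) ρ s (2 * n + 1) c =
      ρ (2 * n + 2) ^ s - if 2 * n + 1 = c then 1 else 0 := by
  unfold cEntry chi
  rw [if_pos (by omega), mul_one]

theorem oddColumn_two_mul : oddColumn ρ s (2 * n) = ρ (2 * n + 1) ^ s :=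
  if_pos (by omega)

theorem oddColumn_two_mul_add_one : oddColumn ρ s (2 * n + 1) = 0 :=
  if_neg (by omega)

theorem delEntry_of_lt {i r c : ℕ} (hi : c + 1 < i) (hc : c + 1 < 2 * n) :
    delEntry n ρ s i r c = cEntry n ρ s r c := by
  simp [delEntry, colIdx, hi, hc]

theorem delEntry_of_le {i r c : ℕ} (hi : i ≤ c + 1) (hc : c + 1 < 2 * n) :
    delEntry n ρ s i r c = cEntry n ρ s r (c + 1) := by
  simp [delEntry, colIdx, hi.not_gt, hc]

theorem delEntry_last {i r c : ℕ} (hc : 2 * n ≤ c + 1) :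
    delEntry n ρ s i r c = oddColumn ρ s r := by
  simp [delEntry, hc.not_gt]

end Entries

theorem Qdel_succ_of_le {n : ℕ} (hn : 1 ≤ n) (ρ : ℕ → ℝ) (s : ℝ) {i : ℕ} (hi : i ≤ 2 * n) :
    Qdel (n + 1) ρ s i = (1 - ρ (2 * n + 2) ^ s) * Qdel n ρ s i := by
  obtain ⟨M, hM⟩ : ∃ M, 2 * n = M + 1 := ⟨2 * n - 1, by omega⟩
  have hpen : ∀ r, delEntry (n + 1) ρ s i r (2 * n) = cEntry (n + 1) ρ s r (2 * n + 1) :=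
    fun r => delEntry_of_le ρ s (by omega) (by omega)
  have hpen' : ∀ r, delEntry (n + 1) ρ s i r M = cEntry (n + 1) ρ s r (2 * n) :=
    fun r => hM ▸ delEntry_of_le ρ s (by omega) (by omega)
  have hlast : ∀ r, delEntry (n + 1) ρ s i r (2 * n + 1) = oddColumn ρ s r :=
    fun r => delEntry_last ρ s (by omega)
  rw [Qdel_eq_leadingDet, Qdel_eq_leadingDet, show 2 * (n + 1) = 2 * n + 2 by ring,
    ← leadingDet_sub_column, leadingDet_succ_of_column_eq_zero]
  · simp only [if_true, hpen, hlast, cEntry_last_row, oddColumn_two_mul_add_one]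
    rw [leadingDet_congr (g := delEntry (n + 1) ρ s i) fun r _ c hc => if_neg (by omega)]
    have key : leadingDet (2 * n + 1) (delEntry (n + 1) ρ s i) =
        leadingDet (2 * n) (delEntry n ρ s i) := by
      have hsub := leadingDet_sub_column M (delEntry (n + 1) ρ s i)
      rw [show M + 2 = 2 * n + 1 by omega, ← hM] at hsub
      rw [← hsub, leadingDet_succ_of_column_eq_zero]
      · simp only [if_true, hpen, hpen', cEntry_penultimate_row ρ s hn]
        rw [leadingDet_congr (g := delEntry n ρ s i)]
        · simp
        · intro r hr c hc
          rw [if_neg hc.ne]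
          rcases Nat.lt_or_ge (c + 1) (2 * n) with h | h
          · rcases Nat.lt_or_ge (c + 1) i with h' | h'
            · rw [delEntry_of_lt ρ s h' (by omega), delEntry_of_lt ρ s h' h,
                cEntry_succ_of_lt ρ s hr hc]
            · rw [delEntry_of_le ρ s h' (by omega), delEntry_of_le ρ s h' h,
                cEntry_succ_of_lt ρ s hr h]
          · rw [show c = M by omega, hpen', delEntry_last ρ s (by omega),
              cEntry_succ_of_le ρ s hr le_rfl]
      · intro r hr
        rw [if_pos rfl, hpen, hpen', cEntry_succ_of_le ρ s hr le_rfl,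
          cEntry_succ_of_le ρ s hr (by omega), sub_self]
    rw [key]
    ring
  · intro r hr
    rw [if_pos rfl, hpen, hlast]
    rcases Nat.lt_succ_iff_lt_or_eq.1 hr with h | rfl
    · rw [cEntry_succ_of_le ρ s h (by omega), sub_self]
    · rw [cEntry_penultimate_row ρ s hn, oddColumn_two_mul]
      simp

/-- A leading block agreeing with `C_{2n+2}` on its first columns, with bottom row that of
index `2n+1`, reduces to `Q_{2n}`. -/
theorem leadingDet_eq_mul_Qdet {n : ℕ} (hn : 1 ≤ n) (ρ : ℕ → ℝ) (s : ℝ) {f : ℕ → ℕ → ℝ}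
    (h : ∀ r ≤ 2 * n, ∀ c < 2 * n, f r c = cEntry (n + 1) ρ s r c) :
    leadingDet (2 * n + 1) f = f (2 * n) (2 * n) * Qdet n ρ s := by
  rw [leadingDet_succ_of_row_eq_zero, Qdet_eq_leadingDet]
  · congr 1
    exact leadingDet_congr fun r hr c hc => by rw [h r hr.le c hc, cEntry_succ_of_lt ρ s hr hc]
  · intro c hc
    rw [h _ le_rfl c hc, cEntry_penultimate_row ρ s hn, if_neg (by omega), if_neg (by omega),
      sub_self]

theorem Qdel_succ_penultimate {n : ℕ} (hn : 1 ≤ n) (ρ : ℕ → ℝ) (s : ℝ) :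
    Qdel (n + 1) ρ s (2 * n + 1) =
      ρ (2 * n + 1) ^ s * (1 - ρ (2 * n + 2) ^ s) * Qdet n ρ s := by
  have hpen : ∀ r, delEntry (n + 1) ρ s (2 * n + 1) r (2 * n) =
      cEntry (n + 1) ρ s r (2 * n + 1) :=
    fun r => delEntry_of_le ρ s (by omega) (by omega)
  have hlast : ∀ r, delEntry (n + 1) ρ s (2 * n + 1) r (2 * n + 1) = oddColumn ρ s r :=
    fun r => delEntry_last ρ s (by omega)
  rw [Qdel_eq_leadingDet, show 2 * (n + 1) = 2 * n + 2 by ring,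
    ← leadingDet_sub_column, leadingDet_succ_of_column_eq_zero, leadingDet_eq_mul_Qdet hn ρ s]
  · simp only [if_true, hpen, hlast, cEntry_last_row, oddColumn_two_mul_add_one,
      cEntry_penultimate_row ρ s hn]
    simp
    ring
  · intro r _ c hc
    rw [if_neg (by omega), delEntry_of_lt ρ s (by omega) (by omega)]
  · intro r hr
    rw [if_pos rfl, hpen, hlast]
    rcases Nat.lt_succ_iff_lt_or_eq.1 hr with h | rfl
    · rw [cEntry_succ_of_le ρ s h (by omega), sub_self]
    · rw [cEntry_penultimate_row ρ s hn, oddColumn_two_mul]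
      simp

theorem Qdel_succ_last {n : ℕ} (hn : 1 ≤ n) (ρ : ℕ → ℝ) (s : ℝ) :
    Qdel (n + 1) ρ s (2 * n + 2) =
      ρ (2 * n + 2) ^ s *
        ((∑ j ∈ Finset.Icc 1 (2 * n), (-1 : ℝ) ^ j * Qdel n ρ s j) -
          ρ (2 * n + 1) ^ s * Qdet n ρ s) := by
  have hcol : ∀ r, ∀ c < 2 * n + 1,
      delEntry (n + 1) ρ s (2 * n + 2) r c = cEntry (n + 1) ρ s r c :=
    fun r c hc => delEntry_of_lt ρ s (by omega) (by omega)
  have hlast : ∀ r, delEntry (n + 1) ρ s (2 * n + 2) r (2 * n + 1) = oddColumn ρ s r :=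
    fun r => delEntry_last ρ s (by omega)
  have hshift : ∑ j ∈ Finset.Icc 1 (2 * n), (-1 : ℝ) ^ j * Qdel n ρ s j =
      ∑ j ∈ Finset.range (2 * n), (-1 : ℝ) ^ (j + 1) * Qdel n ρ s (j + 1) := by
    rw [Finset.range_eq_Ico,
      Finset.sum_Ico_add' (fun j => (-1 : ℝ) ^ j * Qdel n ρ s j) 0 (2 * n) 1, zero_add,
      Finset.Ico_add_one_right_eq_Icc]
  have hrow : leadingDet (2 * n + 1)
      (fun r c => cEntry (n + 1) ρ s (if r < 2 * n then r else r + 1) c) =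
      ρ (2 * n + 2) ^ s * (Qdet n ρ s -
        ∑ j ∈ Finset.Icc 1 (2 * n), (-1 : ℝ) ^ j * Qdel n ρ s j) := by
    rw [leadingDet_succ_row, Finset.sum_range_succ, (Even.add_self (2 * n)).neg_one_pow,
      hshift, mul_sub, Finset.mul_sum, sub_eq_add_neg, ← Finset.sum_neg_distrib, add_comm]
    congr 1
    · simp only [lt_irrefl, if_false, cEntry_last_row]
      rw [if_neg (by omega), Qdet_eq_leadingDet, one_mul, sub_zero]
      congr 1
      exact leadingDet_congr fun r hr c hc => by
        rw [if_pos hr, if_pos hc, cEntry_succ_of_lt ρ s hr hc]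
    · refine Finset.sum_congr rfl fun j hj => ?_
      have hj' : j < 2 * n := Finset.mem_range.1 hj
      simp only [lt_irrefl, if_false, cEntry_last_row]
      rw [if_neg (by omega), Qdel_eq_leadingDet, leadingDet_congr (g := delEntry n ρ s (j + 1)),
        pow_add, (even_two_mul n).neg_one_pow, pow_succ]
      · ring
      · intro r hr c hc
        rw [if_pos hr]
        rcases Nat.lt_or_ge (c + 1) (2 * n) with h | h
        · rcases Nat.lt_or_ge c j with h' | h'
          · rw [if_pos h', delEntry_of_lt ρ s (by omega) h, cEntry_succ_of_lt ρ s hr hc]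
          · rw [if_neg (by omega), delEntry_of_le ρ s (by omega) h, cEntry_succ_of_lt ρ s hr h]
        · rw [if_neg (by omega), delEntry_last ρ s h, cEntry_succ_of_le ρ s hr h]
  rw [Qdel_eq_leadingDet, show 2 * (n + 1) = 2 * n + 2 by ring,
    ← leadingDet_sub_column, leadingDet_add_two_of_column_eq_zero, leadingDet_eq_mul_Qdet hn ρ s,
    leadingDet_congr (N := 2 * n + 1)
      (g := fun r c => cEntry (n + 1) ρ s (if r < 2 * n then r else r + 1) c), hrow]
  · simp only [if_true, hlast, hcol _ (2 * n) (by omega), cEntry_last_row,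
      oddColumn_two_mul_add_one, oddColumn_two_mul, cEntry_penultimate_row ρ s hn]
    simp
    ring
  · intro r _ c hc
    rw [if_neg (by omega), hcol _ c hc]
  · intro r _ c hc
    rw [if_neg (by omega), hcol _ c (by omega)]
  · intro r hr
    rw [if_pos rfl, hlast, hcol _ _ (by omega), cEntry_succ_of_le ρ s hr le_rfl, sub_self]

/-- The values `Q_{2n+2,i}(s)` in terms of the `Q_{2n}`-data:
`Q_{2n+2,i} = (1 − ρ_{2n+2}^s) Q_{2n,i}` for `1 ≤ i ≤ 2n`,
`Q_{2n+2,2n+1} = ρ_{2n+1}^s (1 − ρ_{2n+2}^s) Q_{2n}`, and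
`Q_{2n+2,2n+2} = ρ_{2n+2}^s (Σ_{j=1}^{2n} (−1)^j Q_{2n,j} − ρ_{2n+1}^s Q_{2n})`. -/
theorem statement5 (n : ℕ) (hn : 2 ≤ n) (s : ℝ) (ρ : ℕ → ℝ)
    (hρ : ∀ i : ℕ, 1 ≤ i → i ≤ 2 * n + 2 → ρ i ∈ Set.Ioo (0:ℝ) 1) :
    (∀ i : ℕ, 1 ≤ i → i ≤ 2 * n →
        Qdel (n + 1) ρ s i = (1 - ρ (2 * n + 2) ^ s) * Qdel n ρ s i) ∧
    Qdel (n + 1) ρ s (2 * n + 1) =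
      ρ (2 * n + 1) ^ s * (1 - ρ (2 * n + 2) ^ s) * Qdet n ρ s ∧
    Qdel (n + 1) ρ s (2 * n + 2) =
      ρ (2 * n + 2) ^ s *
        ((∑ j ∈ Finset.Icc 1 (2 * n), (-1 : ℝ) ^ j * Qdel n ρ s j) -
          ρ (2 * n + 1) ^ s * Qdet n ρ s) := by
  have hn' : 1 ≤ n := by omega
  exact ⟨fun i _ hi => Qdel_succ_of_le hn' ρ s hi, Qdel_succ_penultimate hn' ρ s,
    Qdel_succ_last hn' ρ s⟩
end
end

section
/- Let F = {f_1, …, f_m} be an injective CPLIFS whose smallest invariant compact interval is I^F = [0,1]. Then the natural dimension s_F of F (the unique zero of the natural pressure function Φ^F) satisfies s_F = limsup_{n→∞} s_n, where for each n ≥ 1, s_n is the unique nonnegative real with Σ_{w ∈ {1,…,m}^n} |I_w|^{s_n} = 1. -/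
open Set Filter MeasureTheory Topology

noncomputable section

/-- Length of the cylinder interval `I_w = f_w([a,b])`. -/
def cylLen {m : ℕ} (f : Fin m → ℝ → ℝ) (a b : ℝ) (w : List (Fin m)) : ℝ :=
  (volume (fw f w '' Icc a b)).toReal

/-- `Σ_{w ∈ {1,…,m}^n} |I_w|^s`. -/
def cylSum {m : ℕ} (f : Fin m → ℝ → ℝ) (a b : ℝ) (n : ℕ) (s : ℝ) : ℝ :=
  ∑ w : Fin n → Fin m, cylLen f a b (List.ofFn w) ^ s

/-- The natural pressure `Φ^F(s) = limsup_{n→∞} (1/n) log Σ_{w ∈ {1,…,m}^n} |I_w|^s`. -/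
def naturalPressure {m : ℕ} (f : Fin m → ℝ → ℝ) (a b : ℝ) (s : ℝ) : ℝ :=
  limsup (fun n : ℕ => (n : ℝ)⁻¹ * Real.log (cylSum f a b n s)) atTop

/-- `[a,b]` is the smallest nonempty compact interval mapped into itself by all maps. -/
def SmallestInvariantInterval {m : ℕ} (f : Fin m → ℝ → ℝ) (a b : ℝ) : Prop :=
  a ≤ b ∧ (∀ k, MapsTo (f k) (Icc a b) (Icc a b)) ∧
    ∀ a' b' : ℝ, a' ≤ b' → (∀ k, MapsTo (f k) (Icc a' b') (Icc a' b')) →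
      Icc a b ⊆ Icc a' b'

/-- `s` is the natural dimension of the system: the unique nonnegative zero of the natural
pressure function. -/
def IsNaturalDim {m : ℕ} (f : Fin m → ℝ → ℝ) (a b : ℝ) (s : ℝ) : Prop :=
  0 ≤ s ∧ naturalPressure f a b s = 0 ∧
    ∀ t : ℝ, 0 ≤ t → naturalPressure f a b t = 0 → t = s

open scoped NNReal ENNReal

/-- The pieces of linearity cover the real line. -/
lemma iUnion_inPiece {L : ℕ} {bk : Fin L → ℝ} (hb : StrictMono bk) :
    ⋃ i, {x | InPiece bk i x} = univ := by
  classical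
  refine eq_univ_of_forall fun x => ?_
  have hex : ∃ i : ℕ, ∀ j : Fin L, i ≤ (j : ℕ) → x ≤ bk j :=
    ⟨L, fun j hj => absurd j.2 (not_lt.2 hj)⟩
  have hle : Nat.find hex ≤ L := Nat.find_min' hex fun j hj => absurd j.2 (not_lt.2 hj)
  refine mem_iUnion.2 ⟨⟨Nat.find hex, Nat.lt_succ_of_le hle⟩, fun j hj => ?_, Nat.find_spec hex⟩
  have hmin := Nat.find_min hex hj
  push Not at hmin
  obtain ⟨j', hjj', hlt⟩ := hmin
  exact (hb.monotone (Fin.le_def.2 hjj')).trans hlt.le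

lemma measurableSet_inPiece {L : ℕ} (bk : Fin L → ℝ) (i : Fin (L + 1)) :
    MeasurableSet {x | InPiece bk i x} := by
  unfold InPiece
  measurability

/-- A map that is affine with slope `c` on `A` scales the Lebesgue outer measure of `A` by `|c|`. -/
lemma volume_image_of_affineOn {g : ℝ → ℝ} {c : ℝ} {A : Set ℝ}
    (h : ∀ x ∈ A, ∀ y ∈ A, g x - g y = c * (x - y)) :
    volume (g '' A) = ENNReal.ofReal |c| * volume A := by
  rcases A.eq_empty_or_nonempty with rfl | ⟨y, hy⟩
  · simp
  have himg : g '' A = (fun z => (g y - c * y) + z) '' ((fun x => c • x) '' A) := by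
    rw [image_image]
    refine image_congr fun x hx => ?_
    have := h x hx y hy
    simp only [smul_eq_mul]
    linarith
  have hsmul : volume ((fun x => c • x) '' A) = ENNReal.ofReal |c| * volume A := by
    have := Measure.addHaar_smul (volume : Measure ℝ) c A
    rwa [Module.finrank_self, pow_one] at this
  rw [himg, ← hsmul, image_add_left, measure_preimage_add]

/-- Each map of a CPLIFS contracts the Lebesgue outer measure by at least some `r < 1`, and by at
most some finite factor. -/
lemma CPLIFS.exists_volume_image_bounds {m : ℕ} (F : CPLIFS m) (k : Fin m) :
    ∃ r C : ℝ≥0, r < 1 ∧ ∀ A : Set ℝ,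
      volume (F.f k '' A) ≤ r * volume A ∧ volume A ≤ C * volume (F.f k '' A) := by
  set Q : Fin (F.l k + 1) → Set ℝ := disjointed fun i => {x | InPiece (F.b k) i x}
  have hQ : ∀ A i, volume (F.f k '' (A ∩ Q i)) = ENNReal.ofReal |F.ρ k i| * volume (A ∩ Q i) :=
    fun A i => volume_image_of_affineOn fun x hx y hy =>
      F.hpiece k i x y (disjointed_subset _ i hx.2) (disjointed_subset _ i hy.2)
  have hQm : ∀ i, MeasurableSet (Q i) := fun i =>
    disjointedRec (fun _ j ht => ht.diff (measurableSet_inPiece (F.b k) j))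
      (measurableSet_inPiece (F.b k) i)
  have hU : ⋃ i, Q i = univ := by rw [iUnion_disjointed, iUnion_inPiece (F.hb k)]
  have hcover : ∀ A : Set ℝ, A = ⋃ i, A ∩ Q i := fun A => by
    rw [← inter_iUnion, hU, inter_univ]
  have hsum : ∀ A : Set ℝ, volume A = ∑ i, volume (A ∩ Q i) := fun A => by
    rw [← Measure.restrict_apply_univ, ← hU, measure_iUnion (disjoint_disjointed _) hQm,
      tsum_fintype]
    exact Finset.sum_congr rfl fun i _ => by rw [Measure.restrict_apply (hQm i), inter_comm]
  refine ⟨Finset.univ.sup fun i => ‖F.ρ k i‖₊, ∑ i, ‖F.ρ k i‖₊⁻¹, ?_, fun A => ⟨?_, ?_⟩⟩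
  · refine (Finset.sup_lt_iff zero_lt_one).2 fun i _ => ?_
    have := F.hρ1 k i
    rwa [← Real.norm_eq_abs, ← coe_nnnorm, NNReal.coe_lt_one] at this
  · calc volume (F.f k '' A) ≤ ∑ i, volume (F.f k '' (A ∩ Q i)) := by
          conv_lhs => rw [hcover A, image_iUnion]
          exact measure_iUnion_fintype_le _ _
      _ ≤ ∑ i, ((Finset.univ.sup fun i => ‖F.ρ k i‖₊ : ℝ≥0) : ℝ≥0∞) * volume (A ∩ Q i) := by
          refine Finset.sum_le_sum fun i _ => ?_
          rw [hQ, ← Real.norm_eq_abs, ofReal_norm, enorm_eq_nnnorm]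
          gcongr
          exact Finset.le_sup (f := fun i => ‖F.ρ k i‖₊) (Finset.mem_univ i)
      _ = _ := by rw [← Finset.mul_sum, ← hsum]
  · rw [ENNReal.ofNNReal_finsetSum, Finset.sum_mul, hsum]
    refine Finset.sum_le_sum fun i _ => ?_
    have h0 : ‖F.ρ k i‖₊ ≠ 0 := nnnorm_ne_zero_iff.2 (F.hρ0 k i)
    calc volume (A ∩ Q i) = (‖F.ρ k i‖₊⁻¹ : ℝ≥0) * volume (F.f k '' (A ∩ Q i)) := by
          rw [hQ, ← Real.norm_eq_abs, ofReal_norm, enorm_eq_nnnorm, ← mul_assoc,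
            ← ENNReal.coe_mul, inv_mul_cancel₀ h0, ENNReal.coe_one, one_mul]
      _ ≤ _ := by gcongr; exact inter_subset_left

/-- Cylinders of level `n` have length between `C⁻ⁿ` and `rⁿ`. -/
lemma CPLIFS.exists_cylLen_bounds {m : ℕ} (F : CPLIFS m) :
    ∃ r C : ℝ, 0 < r ∧ r < 1 ∧ 0 < C ∧ ∀ w : List (Fin m),
      (C ^ w.length)⁻¹ ≤ cylLen F.f 0 1 w ∧ cylLen F.f 0 1 w ≤ r ^ w.length := by
  choose r C hr hA using F.exists_volume_image_bounds
  set R : ℝ≥0 := max 2⁻¹ (Finset.univ.sup r)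
  set D : ℝ≥0 := max 1 (Finset.univ.sup C)
  have hR1 : R < 1 :=
    max_lt (by norm_num) ((Finset.sup_lt_iff zero_lt_one).2 fun k _ => hr k)
  have hrR : ∀ k, r k ≤ R := fun k => (Finset.le_sup (Finset.mem_univ k)).trans (le_max_right _ _)
  have hCD : ∀ k, C k ≤ D := fun k => (Finset.le_sup (Finset.mem_univ k)).trans (le_max_right _ _)
  have hD0 : 0 < D := zero_lt_one.trans_le (le_max_left _ _)
  have hR0 : 0 < R := lt_max_of_lt_left (by norm_num)
  have key : ∀ w : List (Fin m), volume (fw F.f w '' Icc 0 1) ≤ (R ^ w.length : ℝ≥0) ∧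
      1 ≤ (D ^ w.length : ℝ≥0) * volume (fw F.f w '' Icc 0 1) := by
    intro w
    induction w with
    | nil => simp [fw]
    | cons k w ih =>
      have hcomp : fw F.f (k :: w) '' Icc 0 1 = F.f k '' (fw F.f w '' Icc 0 1) := by
        rw [← image_comp]; rfl
      rw [hcomp, List.length_cons, pow_succ', pow_succ', ENNReal.coe_mul, ENNReal.coe_mul]
      refine ⟨((hA k _).1).trans ?_, ih.2.trans ?_⟩
      · have := hrR k
        have := ih.1
        gcongr
      · rw [mul_comm (D : ℝ≥0∞), mul_assoc]
        have := hCD k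
        gcongr
        refine ((hA k _).2).trans ?_
        gcongr
  refine ⟨R, D, hR0, hR1, hD0, fun w => ?_⟩
  obtain ⟨h1, h2⟩ := key w
  have htop : volume (fw F.f w '' Icc 0 1) ≠ ∞ := ne_top_of_le_ne_top ENNReal.coe_ne_top h1
  unfold cylLen
  constructor
  · have := ENNReal.toReal_mono (ENNReal.mul_ne_top ENNReal.coe_ne_top htop) h2
    rw [ENNReal.toReal_mul] at this
    rw [inv_le_iff_one_le_mul₀' (by positivity)]
    simpa using this
  · simpa using ENNReal.toReal_mono ENNReal.coe_ne_top h1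

/-- Increments of the normalised logarithm `s ↦ n⁻¹ log ∑ L wˢ` when all `L w ∈ [C⁻ⁿ, rⁿ]`. -/
lemma normalized_log_sum_rpow_increment {ι : Type*} [Fintype ι] [Nonempty ι] {L : ι → ℝ}
    {r C : ℝ} (hr : 0 < r) (hC : 0 < C) {n : ℕ} (hn : 1 ≤ n)
    (hlow : ∀ w, (C ^ n)⁻¹ ≤ L w) (hup : ∀ w, L w ≤ r ^ n) {s t : ℝ} (hst : s ≤ t) :
    (n : ℝ)⁻¹ * Real.log (∑ w, L w ^ t) ≤
        (n : ℝ)⁻¹ * Real.log (∑ w, L w ^ s) + (t - s) * Real.log r ∧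
      (n : ℝ)⁻¹ * Real.log (∑ w, L w ^ s) - (t - s) * Real.log C ≤
        (n : ℝ)⁻¹ * Real.log (∑ w, L w ^ t) := by
  have hn0 : (0 : ℝ) < n := by exact_mod_cast hn
  have hpos : ∀ w, 0 < L w := fun w => lt_of_lt_of_le (by positivity) (hlow w)
  have hsum : ∀ u : ℝ, 0 < ∑ w, L w ^ u := fun u =>
    Finset.sum_pos (fun w _ => Real.rpow_pos_of_pos (hpos w) u) Finset.univ_nonempty
  have hsplit : ∀ w, L w ^ t = L w ^ (t - s) * L w ^ s := fun w => by
    rw [← Real.rpow_add (hpos w), sub_add_cancel]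
  have hs := sub_nonneg.2 hst
  have h1 : ∑ w, L w ^ t ≤ (r ^ n) ^ (t - s) * ∑ w, L w ^ s := by
    rw [Finset.mul_sum]
    refine Finset.sum_le_sum fun w _ => ?_
    rw [hsplit]
    exact mul_le_mul_of_nonneg_right (Real.rpow_le_rpow (hpos w).le (hup w) hs)
      (Real.rpow_nonneg (hpos w).le s)
  have h2 : ((C ^ n)⁻¹) ^ (t - s) * ∑ w, L w ^ s ≤ ∑ w, L w ^ t := by
    rw [Finset.mul_sum]
    refine Finset.sum_le_sum fun w _ => ?_
    rw [hsplit]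
    exact mul_le_mul_of_nonneg_right (Real.rpow_le_rpow (by positivity) (hlow w) hs)
      (Real.rpow_nonneg (hpos w).le s)
  have h1' := Real.log_le_log (hsum t) h1
  have h2' := Real.log_le_log (mul_pos (by positivity) (hsum s)) h2
  rw [Real.log_mul (by positivity) (hsum s).ne', Real.log_rpow (by positivity), Real.log_pow] at h1'
  rw [Real.log_mul (by positivity) (hsum s).ne', Real.log_rpow (by positivity), Real.log_inv,
    Real.log_pow] at h2'
  constructor
  · rw [inv_mul_le_iff₀ hn0, mul_add, mul_inv_cancel_left₀ hn0.ne']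
    linarith
  · rw [le_inv_mul_iff₀ hn0, mul_sub, mul_inv_cancel_left₀ hn0.ne']
    linarith

/-- If `p n` decreases in `s` at least at rate `a > 0` and at most at rate `b`, and vanishes at
`u n`, then a zero of `limsup p n` is the `limsup` of the zeros `u n`. -/
lemma eq_limsup_zeros {p : ℕ → ℝ → ℝ} {u : ℕ → ℝ} {a b M s : ℝ} (ha : 0 < a)
    (hup : ∀ n, 1 ≤ n → ∀ x y, x ≤ y → p n y ≤ p n x - (y - x) * a)
    (hlow : ∀ n, 1 ≤ n → ∀ x y, x ≤ y → p n x - (y - x) * b ≤ p n y)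
    (h0 : ∀ n, 1 ≤ n → p n 0 = M)
    (hu0 : ∀ n, 1 ≤ n → 0 ≤ u n) (hu : ∀ n, 1 ≤ n → p n (u n) = 0)
    (hs : 0 ≤ s) (hlim : limsup (fun n => p n s) atTop = 0) :
    s = limsup u atTop := by
  have hub : ∀ᶠ n in atTop, u n ≤ M / a := by
    filter_upwards [eventually_ge_atTop 1] with n hn
    have := hup n hn 0 (u n) (hu0 n hn)
    rw [h0 n hn, hu n hn] at this
    rw [le_div_iff₀ ha]
    linarith
  have hub0 : ∀ᶠ n in atTop, 0 ≤ u n := (eventually_ge_atTop 1).mono hu0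
  have hpM : ∀ᶠ n in atTop, p n s ≤ M := by
    filter_upwards [eventually_ge_atTop 1] with n hn
    have := hup n hn 0 s hs
    rw [h0 n hn] at this
    nlinarith
  have hpm : ∀ᶠ n in atTop, M - s * b ≤ p n s := by
    filter_upwards [eventually_ge_atTop 1] with n hn
    have := hlow n hn 0 s hs
    rwa [h0 n hn, sub_zero] at this
  have hubdd : IsBoundedUnder (· ≤ ·) atTop u := isBoundedUnder_of_eventually_le hub
  have hucob : IsCoboundedUnder (· ≤ ·) atTop u :=
    (isBoundedUnder_of_eventually_ge hub0).isCoboundedUnder_le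
  have hpbdd : IsBoundedUnder (· ≤ ·) atTop fun n => p n s := isBoundedUnder_of_eventually_le hpM
  have hpcob : IsCoboundedUnder (· ≤ ·) atTop fun n => p n s :=
    (isBoundedUnder_of_eventually_ge hpm).isCoboundedUnder_le
  refine le_antisymm (le_of_forall_lt fun y hy => ?_) (le_of_forall_gt fun y hy => ?_)
  · by_contra hcon
    push Not at hcon
    obtain ⟨z, hyz, hzs⟩ := exists_between hy
    have hev := eventually_lt_of_limsup_lt (hcon.trans_lt hyz) hubdd
    have hle : limsup (fun n => p n s) atTop ≤ -((s - z) * a) := by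
      refine limsup_le_of_le hpcob ?_
      filter_upwards [hev, eventually_ge_atTop 1] with n hlt hn
      have := hup n hn (u n) s (hlt.trans hzs).le
      rw [hu n hn] at this
      nlinarith
    rw [hlim] at hle
    nlinarith [mul_pos (sub_pos.2 hzs) ha]
  · by_contra hcon
    push Not at hcon
    obtain ⟨z, hsz, hzy⟩ := exists_between hy
    have hfr := frequently_lt_of_lt_limsup hucob (hzy.trans_le hcon)
    have hle : (z - s) * a ≤ limsup (fun n => p n s) atTop := by
      refine le_limsup_of_frequently_le ?_ hpbdd
      refine (hfr.and_eventually (eventually_ge_atTop 1)).mono fun n ⟨hlt, hn⟩ => ?_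
      have := hup n hn s (u n) (hsz.trans hlt).le
      rw [hu n hn] at this
      nlinarith
    rw [hlim] at hle
    nlinarith [mul_pos (sub_pos.2 hsz) ha]

/-- For an injective CPLIFS with smallest invariant compact interval
`[0,1]`, the natural dimension `s_F` equals `limsup_{n→∞} s_n`, where `s_n ≥ 0` is the
unique solution of `Σ_{w ∈ {1,…,m}^n} |I_w|^{s_n} = 1`. -/
theorem statement6 {m : ℕ} (F : CPLIFS m)
    (hinj : ∀ k, Function.Injective (F.f k))
    (hI : SmallestInvariantInterval F.f 0 1)
    (sF : ℝ) (hsF : IsNaturalDim F.f 0 1 sF)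
    (sn : ℕ → ℝ)
    (hsn : ∀ n : ℕ, 1 ≤ n → 0 ≤ sn n ∧ cylSum F.f 0 1 n (sn n) = 1) :
    sF = limsup sn atTop := by
  obtain ⟨r, C, hr0, hr1, hC, hbd⟩ := F.exists_cylLen_bounds
  have : Nonempty (Fin m) := ⟨⟨0, by have := F.hm; omega⟩⟩
  have hinc := fun (n : ℕ) (hn : 1 ≤ n) (x y : ℝ) (hxy : x ≤ y) =>
    normalized_log_sum_rpow_increment (L := fun w : Fin n → Fin m => cylLen F.f 0 1 (List.ofFn w))
      hr0 hC hn (fun w => by simpa using (hbd (List.ofFn w)).1)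
      (fun w => by simpa using (hbd (List.ofFn w)).2) hxy
  refine eq_limsup_zeros (p := fun n s => (n : ℝ)⁻¹ * Real.log (cylSum F.f 0 1 n s))
    (a := -Real.log r) (b := Real.log C) (M := Real.log m)
    (neg_pos.2 (Real.log_neg hr0 hr1)) (fun n hn x y hxy => ?_)
    (fun n hn x y hxy => (hinc n hn x y hxy).2) (fun n hn => ?_) (fun n hn => (hsn n hn).1)
    (fun n hn => by simp [(hsn n hn).2]) hsF.1 hsF.2.1
  · rw [mul_neg, sub_neg_eq_add]
    exact (hinc n hn x y hxy).1
  · have hn0 : (n : ℝ) ≠ 0 := by exact_mod_cast (Nat.one_le_iff_ne_zero.1 hn)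
    simp [cylSum, hn0]
end
end

section
/- Let F = {f_1, …, f_m} be an injective CPLIFS satisfying the IOSC, with attractor Λ and associated expanding map T. Then Λ equals the set of points whose forward T-orbit never leaves the union of the first cylinder intervals: Λ = {x ∈ ⋃_{k=1}^m I_k : T^t(x) ∈ ⋃_{k=1}^m I_k for every t ≥ 0}. -/
open Set Filter MeasureTheory Topology

noncomputable section

/-- The interval open set condition: the first cylinder intervals `f k ([a,b])` are
pairwise disjoint. -/
def IOSC {m : ℕ} (f : Fin m → ℝ → ℝ) (a b : ℝ) : Prop :=
  ∀ k k' : Fin m, k ≠ k' → Disjoint (f k '' Icc a b) (f k' '' Icc a b)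

/-- `T` is the expanding map associated with the (injective) system `f` on `[a,b]`:
on each first cylinder interval `I_k = f k ([a,b])` it is the inverse of `f k`. -/
def IsExpandingMapOf {m : ℕ} (f : Fin m → ℝ → ℝ) (a b : ℝ) (T : ℝ → ℝ) : Prop :=
  ∀ k, ∀ x ∈ Icc a b, T (f k x) = x

/-- Two points with no breaking point strictly between them lie in a common piece. -/
lemma exists_inPiece_of_forall_notMem_Ioo {L : ℕ} {bk : Fin L → ℝ} (hbk : StrictMono bk)
    {x y : ℝ} (hxy : x ≤ y) (h : ∀ j, bk j ∉ Ioo x y) :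
    ∃ i, InPiece bk i x ∧ InPiece bk i y := by
  by_cases hall : ∀ j, bk j ≤ x
  · refine ⟨Fin.last L, ⟨fun j _ => hall j, fun j hj => ?_⟩,
      fun j _ => (hall j).trans hxy, fun j hj => ?_⟩ <;>
    · have := j.isLt
      simp only [Fin.val_last] at hj
      omega
  · push Not at hall
    obtain ⟨j, hj, hmin⟩ := WellFounded.has_min (wellFounded_lt (α := Fin L)) {j | x < bk j} hall
    have hlow : ∀ j' : Fin L, (j' : ℕ) < (j.castSucc : ℕ) → bk j' ≤ x := fun j' hj' =>
      not_lt.1 fun hx => hmin j' hx hj'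
    have hyj : y ≤ bk j := not_lt.1 fun hy => h j ⟨hj, hy⟩
    have hup : ∀ j' : Fin L, (j.castSucc : ℕ) ≤ (j' : ℕ) → y ≤ bk j' := fun j' hj' =>
      hyj.trans (hbk.monotone hj')
    exact ⟨j.castSucc, ⟨hlow, fun j' hj' => hxy.trans (hup j' hj')⟩,
      fun j' hj' => (hlow j' hj').trans hxy, hup⟩

/-- A map that is `r`-Lipschitz on each piece is `r`-Lipschitz. -/
lemma dist_le_of_forall_inPiece {L : ℕ} {bk : Fin L → ℝ} (hbk : StrictMono bk) {g : ℝ → ℝ}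
    {r : ℝ} (hg : ∀ i x y, InPiece bk i x → InPiece bk i y → dist (g x) (g y) ≤ r * dist x y)
    (x y : ℝ) : dist (g x) (g y) ≤ r * dist x y := by
  have key : ∀ n : ℕ, ∀ x y : ℝ, x ≤ y → (Finset.univ.filter fun j => bk j ∈ Ioo x y).card = n →
      dist (g x) (g y) ≤ r * dist x y := by
    intro n
    induction n using Nat.strong_induction_on with
    | _ n ih =>
      intro x y hxy hn
      by_cases h : ∀ j, bk j ∉ Ioo x y
      · obtain ⟨i, hx, hy⟩ := exists_inPiece_of_forall_notMem_Ioo hbk hxy h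
        exact hg i x y hx hy
      · push Not at h
        obtain ⟨j, hxj, hjy⟩ := h
        have hleft := ih _ (by
          rw [← hn]
          refine Finset.card_lt_card (Finset.ssubset_iff_of_subset ?_ |>.2 ⟨j, ?_, ?_⟩)
          · intro j' hj'
            simp only [Finset.mem_filter, Finset.mem_univ, true_and, mem_Ioo] at hj' ⊢
            exact ⟨hj'.1, hj'.2.trans hjy⟩
          · simp [hxj, hjy]
          · simp) x (bk j) hxj.le rfl
        have hright := ih _ (by
          rw [← hn]
          refine Finset.card_lt_card (Finset.ssubset_iff_of_subset ?_ |>.2 ⟨j, ?_, ?_⟩)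
          · intro j' hj'
            simp only [Finset.mem_filter, Finset.mem_univ, true_and, mem_Ioo] at hj' ⊢
            exact ⟨hxj.trans hj'.1, hj'.2⟩
          · simp [hxj, hjy]
          · simp) (bk j) y hjy.le rfl
        have hsplit : dist x y = dist x (bk j) + dist (bk j) y := by
          rw [dist_comm x y, dist_comm x, dist_comm _ y, Real.dist_eq, Real.dist_eq, Real.dist_eq,
            abs_of_nonneg (by linarith), abs_of_nonneg (by linarith), abs_of_nonneg (by linarith)]
          ring
        calc dist (g x) (g y) ≤ dist (g x) (g (bk j)) + dist (g (bk j)) (g y) :=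
              dist_triangle _ _ _
          _ ≤ r * dist x y := by rw [hsplit, mul_add]; exact add_le_add hleft hright
  rcases le_total x y with hxy | hxy
  · exact key _ x y hxy rfl
  · rw [dist_comm, dist_comm x]
    exact key _ y x hxy rfl

/-- The maps of a CPLIFS are contractions with a common ratio. -/
lemma CPLIFS.exists_contraction_ratio_s10 {m : ℕ} (F : CPLIFS m) :
    ∃ r : ℝ, 0 ≤ r ∧ r < 1 ∧ ∀ k x y, dist (F.f k x) (F.f k y) ≤ r * dist x y := by
  have : Nonempty (Σ k, Fin (F.l k + 1)) := ⟨⟨⟨0, by have := F.hm; omega⟩, 0⟩⟩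
  obtain ⟨p, hp⟩ := Finite.exists_max fun p : Σ k, Fin (F.l k + 1) => |F.ρ p.1 p.2|
  refine ⟨|F.ρ p.1 p.2|, abs_nonneg _, F.hρ1 _ _, fun k => dist_le_of_forall_inPiece (F.hb k) ?_⟩
  intro i x y hx hy
  rw [Real.dist_eq, F.hpiece k i x y hx hy, abs_mul, Real.dist_eq]
  exact mul_le_mul_of_nonneg_right (hp ⟨k, i⟩) (abs_nonneg _)

/-- For a family of contractions with a common ratio, a bounded set covered by its own images is
contained in every nonempty closed set that the family maps into itself. -/
lemma subset_of_subset_iUnion_image {ι X : Type*} [PseudoMetricSpace X] {f : ι → X → X} {r : ℝ}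
    (hr0 : 0 ≤ r) (hr1 : r < 1) (hf : ∀ k x y, dist (f k x) (f k y) ≤ r * dist x y)
    {S A : Set X} (hS : Bornology.IsBounded S) (hSf : S ⊆ ⋃ k, f k '' S)
    (hA : IsClosed A) (hAne : A.Nonempty) (hAf : ∀ k, MapsTo (f k) A A) : S ⊆ A := by
  obtain ⟨p, hp⟩ := hAne
  obtain ⟨C, hC⟩ := hS.subset_closedBall p
  have hstep : ∀ k y, Metric.infDist (f k y) A ≤ r * Metric.infDist y A := by
    intro k y
    refine le_of_forall_pos_le_add fun ε hε => ?_
    obtain ⟨z, hz, hzy⟩ := (Metric.infDist_lt_iff ⟨p, hp⟩).1 (lt_add_of_pos_right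
      (Metric.infDist y A) hε)
    calc Metric.infDist (f k y) A ≤ dist (f k y) (f k z) := Metric.infDist_le_dist_of_mem (hAf k hz)
      _ ≤ r * dist y z := hf k y z
      _ ≤ r * (Metric.infDist y A + ε) := mul_le_mul_of_nonneg_left hzy.le hr0
      _ ≤ r * Metric.infDist y A + ε := by nlinarith
  have hpow : ∀ n : ℕ, ∀ x ∈ S, Metric.infDist x A ≤ r ^ n * C := by
    intro n
    induction n with
    | zero =>
      intro x hx
      simpa using (Metric.infDist_le_dist_of_mem hp).trans (hC hx)
    | succ n ih =>
      intro x hx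
      obtain ⟨k, y, hy, rfl⟩ := mem_iUnion.1 (hSf hx)
      calc Metric.infDist (f k y) A ≤ r * Metric.infDist y A := hstep k y
        _ ≤ r * (r ^ n * C) := mul_le_mul_of_nonneg_left (ih y hy) hr0
        _ = r ^ (n + 1) * C := by ring
  intro x hx
  rw [hA.mem_iff_infDist_zero ⟨p, hp⟩]
  refine le_antisymm ?_ Metric.infDist_nonneg
  have hlim : Tendsto (fun n : ℕ => r ^ n * C) atTop (𝓝 0) := by
    simpa using (tendsto_pow_atTop_nhds_zero_of_lt_one hr0 hr1).mul_const C
  exact ge_of_tendsto' hlim fun n => hpow n x hx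

/-- For an injective CPLIFS satisfying the IOSC, the attractor equals the
set of points whose forward orbit under the associated expanding map `T` never leaves the
union of the first cylinder intervals. -/
theorem statement10 {m : ℕ} (F : CPLIFS m)
    (hinj : ∀ k, Function.Injective (F.f k))
    (a b : ℝ) (hI : SmallestInvariantInterval F.f a b)
    (hiosc : IOSC F.f a b)
    (Λ : Set ℝ) (hΛ : IsAttractor F Λ)
    (T : ℝ → ℝ) (hT : IsExpandingMapOf F.f a b T) :
    Λ = {x : ℝ | ∀ t : ℕ, T^[t] x ∈ ⋃ k, F.f k '' Icc a b} := by
  obtain ⟨r, hr0, hr1, hf⟩ := F.exists_contraction_ratio_s10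
  obtain ⟨hab, hmaps, -⟩ := hI
  obtain ⟨hne, hcomp, hinv⟩ := hΛ
  have hΛI : Λ ⊆ Icc a b := subset_of_subset_iUnion_image hr0 hr1 hf hcomp.isBounded hinv.subset
    isClosed_Icc (nonempty_Icc.2 hab) hmaps
  refine Subset.antisymm (fun x hx t => ?_) ?_
  · have hTΛ : MapsTo T Λ Λ := by
      intro y hy
      rw [hinv] at hy
      obtain ⟨k, z, hz, rfl⟩ := mem_iUnion.1 hy
      rwa [hT k z (hΛI hz)]
    have hmem := hTΛ.iterate t hx
    rw [hinv] at hmem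
    exact iUnion_mono (fun k => image_mono hΛI) hmem
  · refine subset_of_subset_iUnion_image hr0 hr1 hf ((Metric.isBounded_Icc a b).subset ?_) ?_
      hcomp.isClosed hne fun k y hy => ?_
    · intro x hx
      obtain ⟨k, y, hy, hyx⟩ := mem_iUnion.1 (hx 0)
      rw [Function.iterate_zero, id] at hyx
      exact hyx ▸ hmaps k hy
    · intro x hx
      obtain ⟨k, y, hy, hyx⟩ := mem_iUnion.1 (hx 0)
      rw [Function.iterate_zero, id] at hyx
      refine mem_iUnion.2 ⟨k, y, fun t => ?_, hyx⟩
      have := hx (t + 1)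
      rwa [Function.iterate_succ_apply, ← hyx, hT k y hy] at this
    · rw [hinv]
      exact mem_iUnion.2 ⟨k, y, hy, rfl⟩
end
end
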